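/- (i) There is a constant C > 0 such that for all λ ≥ 1, all dyadic integers N₁ ≥ N₂ ≥ 1, and all g₁, g₂ : ℝ×(1/λ)ℤ → ℂ with gⱼ supported in {k : |k| ≤ 2Nⱼ, and moreover |k| ≥ Nⱼ/2 when Nⱼ > 1}, the free waves on ℝ×𝕋_λ satisfy ‖(U_λ g₁)(U_λ g₂)‖_{L²([0,1]×ℝ×𝕋_λ)} ≤ C (1/λ + N₂/N₁)^{1/2} ‖g₁‖_{L²_λ} ‖g₂‖_{L²_λ}. (ii) Let m ≥ 2, n ≥ 1 be integers and d = m + n. There is a constant C = C(m,n) > 0 such that for all λ ≥ 1, all dyadic integers N₁ ≥ N₂ ≥ 1, and all g₁, g₂ : ℝ^m×(1/λ)ℤⁿ → ℂ with gⱼ supported in {k : |k| ≤ 2Nⱼ, and moreover |k| ≥ Nⱼ/2 when Nⱼ > 1}, one has the global-in-time estimate ‖(U_λ g₁)(U_λ g₂)‖_{L²(ℝ×ℝ^m×𝕋ⁿ_λ)} ≤ C (N₂^{d−3}/λ + N₂^{d−1}/N₁)^{1/2} ‖g₁‖_{L²_λ} ‖g₂‖_{L²_λ}. -/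

import Mathlib

noncomputable section
open MeasureTheory
open scoped ENNReal NNReal Classical

/-- `|k|` for `k = (ζ, j/λ) ∈ ℝ^m × (1/λ)ℤⁿ`. -/
def freqNorm (lam : ℝ) {m n : ℕ} (ζ : Fin m → ℝ) (j : Fin n → ℤ) : ℝ :=
  Real.sqrt ((∑ i, (ζ i) ^ 2) + ∑ i, ((j i : ℝ) / lam) ^ 2)

/-- The free Schrödinger wave `(U_λ g)(t, x, y) = ∫ g(k) e^{i(z·k − t|k|²)} (dk)_λ`
on `ℝ^m × 𝕋ⁿ_λ`, where `g ζ j` stands for `g (ζ, j/λ)`. -/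
def waveU (lam : ℝ) {m n : ℕ} (g : (Fin m → ℝ) → (Fin n → ℤ) → ℂ)
    (t : ℝ) (x : Fin m → ℝ) (y : Fin n → ℝ) : ℂ :=
  ((1 / lam ^ n : ℝ) : ℂ) * ∑' j : Fin n → ℤ, ∫ ζ : Fin m → ℝ,
    g ζ j * Complex.exp (Complex.I *
      ((((∑ i, x i * ζ i) + ∑ i, y i * ((j i : ℝ) / lam))
        - t * ((∑ i, (ζ i) ^ 2) + ∑ i, ((j i : ℝ) / lam) ^ 2) : ℝ) : ℂ))

/-- Squared `L²_λ` norm of Fourier data on `ℝ^m × (1/λ)ℤⁿ`. -/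
def l2sq (lam : ℝ) {m n : ℕ} (g : (Fin m → ℝ) → (Fin n → ℤ) → ℂ) : ℝ≥0∞ :=
  ENNReal.ofReal (1 / lam ^ n) * ∑' j : Fin n → ℤ, ∫⁻ ζ : Fin m → ℝ, (‖g ζ j‖₊ : ℝ≥0∞) ^ 2

/-- `N` is a dyadic integer, i.e. `N ∈ 2^ℕ`. -/
def IsDyadic (N : ℝ) : Prop := ∃ a : ℕ, N = 2 ^ a

/-- `g` is supported in `{k : |k| ≤ 2N, and moreover |k| ≥ N/2 when N > 1}`. -/
def SuppIn (lam : ℝ) {m n : ℕ} (g : (Fin m → ℝ) → (Fin n → ℤ) → ℂ) (N : ℝ) : Prop :=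
  ∀ ζ j, g ζ j ≠ 0 → freqNorm lam ζ j ≤ 2 * N ∧ (1 < N → N / 2 ≤ freqNorm lam ζ j)

/-- One period box of the torus `𝕋ⁿ_λ`. -/
def torusBox (lam : ℝ) (n : ℕ) : Set (Fin n → ℝ) :=
  Set.Icc 0 (fun _ => 2 * Real.pi * lam)


lemma expand_bound {Y P : Type*} [MeasurableSpace Y] [MeasurableSpace P]
    (μ : Measure Y) [SigmaFinite μ] (ν : Measure P) [IsFiniteMeasure ν]
    (h : Y → ℂ) (hm : Measurable h) (hh : Integrable h μ)
    (θ : P → Y → ℝ) (hθ : Measurable (Function.uncurry θ)) :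
    ∫⁻ p, ‖∫ y, h y * Complex.exp (Complex.I * (θ p y : ℂ)) ∂μ‖ₑ ^ 2 ∂ν ≤
      ∫⁻ z : Y × Y, ‖h z.1‖ₑ * ‖h z.2‖ₑ *
        ‖∫ p, Complex.exp (Complex.I * ((θ p z.1 - θ p z.2 : ℝ) : ℂ)) ∂ν‖ₑ ∂(μ.prod μ) := by
  set F : P → ℂ := fun p => ∫ y, h y * Complex.exp (Complex.I * (θ p y : ℂ)) ∂μ with hF
  have hFm : StronglyMeasurable F := by
    refine StronglyMeasurable.integral_prod_right (f := fun p y => h y * Complex.exp (Complex.I * (θ p y : ℂ))) ?_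
    apply Measurable.stronglyMeasurable
    have : Measurable (fun z : P × Y => θ z.1 z.2) := hθ
    unfold Function.uncurry
    fun_prop
  have hFb : ∀ p, ‖F p‖ ≤ ∫ y, ‖h y‖ ∂μ := by
    intro p
    refine (norm_integral_le_integral_norm _).trans (le_of_eq ?_)
    congr 1; ext y
    rw [norm_mul, mul_comm Complex.I, Complex.norm_exp_ofReal_mul_I, mul_one]
  set G : P → Y × Y → ℂ := fun p z => (h z.1 * (starRingEnd ℂ) (h z.2)) *
        Complex.exp (Complex.I * ((θ p z.1 - θ p z.2 : ℝ) : ℂ)) with hG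
  have hFF : ∀ p, F p * (starRingEnd ℂ) (F p) = ∫ z, G p z ∂(μ.prod μ) := by
    intro p
    rw [hF]
    simp only
    rw [← integral_conj, ← integral_prod_mul]
    congr 1; ext z
    simp only [hG, map_mul, ← Complex.exp_conj, Complex.conj_I, Complex.conj_ofReal]
    have : Complex.exp (Complex.I * ((θ p z.1 - θ p z.2 : ℝ) : ℂ)) =
        Complex.exp (Complex.I * (θ p z.1 : ℂ)) * Complex.exp (-Complex.I * (θ p z.2 : ℂ)) := by
      rw [← Complex.exp_add]; congr 1; push_cast; ring
    rw [this]; ring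
  have hGint : Integrable (Function.uncurry G) (ν.prod (μ.prod μ)) := by
    have h1 : Integrable (fun z : Y × Y => h z.1 * (starRingEnd ℂ) (h z.2)) (μ.prod μ) := by
      refine Integrable.mul_prod (g := fun y => (starRingEnd ℂ) (h y)) hh ?_
      exact (Complex.conjLIE.toContinuousLinearEquiv.toContinuousLinearMap.integrable_comp hh)
    have h2 : Integrable (fun q : P × (Y × Y) => h q.2.1 * (starRingEnd ℂ) (h q.2.2)) (ν.prod (μ.prod μ)) := 
      h1.comp_snd ν
    refine h2.mono ?_ ?_
    · apply Measurable.aestronglyMeasurable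
      have a1 : Measurable (fun q : P × (Y × Y) => θ q.1 q.2.1) := hθ.comp (by fun_prop : Measurable (fun q : P × (Y × Y) => (q.1, q.2.1)))
      have a2 : Measurable (fun q : P × (Y × Y) => θ q.1 q.2.2) := hθ.comp (by fun_prop : Measurable (fun q : P × (Y × Y) => (q.1, q.2.2)))
      unfold Function.uncurry
      simp only [hG]
      have a3 : Measurable (fun q : P × (Y × Y) => (starRingEnd ℂ) (h q.2.2)) :=
        Complex.continuous_conj.measurable.comp (by fun_prop)
      fun_prop
    · refine Filter.Eventually.of_forall fun q => ?_
      simp only [Function.uncurry, hG]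
      rw [norm_mul, mul_comm Complex.I, Complex.norm_exp_ofReal_mul_I, mul_one]
  have e1 : ∫⁻ p, ‖F p‖ₑ ^ 2 ∂ν = ‖∫ p, F p * (starRingEnd ℂ) (F p) ∂ν‖ₑ := by
    have i1 : Integrable (fun p => ‖F p‖ ^ 2) ν := by
      refine Integrable.mono' (integrable_const ((∫ y, ‖h y‖ ∂μ) ^ 2)) ?_ ?_
      · exact (hFm.norm.pow 2).aestronglyMeasurable
      · refine Filter.Eventually.of_forall fun p => ?_
        rw [Real.norm_of_nonneg (by positivity)]
        exact pow_le_pow_left₀ (norm_nonneg _) (hFb p) 2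
    have i2 : ∫ p, F p * (starRingEnd ℂ) (F p) ∂ν = ((∫ p, ‖F p‖ ^ 2 ∂ν : ℝ) : ℂ) := by
      rw [← integral_complex_ofReal]
      congr 1; ext p
      rw [Complex.mul_conj, Complex.normSq_eq_norm_sq]
    rw [i2, ← ofReal_norm, Complex.norm_real, Real.norm_of_nonneg (integral_nonneg fun _ => by positivity),
      ofReal_integral_eq_lintegral_ofReal i1 (Filter.Eventually.of_forall fun _ => by positivity)]
    congr 1; ext p
    rw [ENNReal.ofReal_pow (norm_nonneg _), ofReal_norm]
  calc ∫⁻ p, ‖F p‖ₑ ^ 2 ∂ν = ‖∫ p, F p * (starRingEnd ℂ) (F p) ∂ν‖ₑ := e1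
    _ = ‖∫ p, ∫ z, G p z ∂(μ.prod μ) ∂ν‖ₑ := by simp_rw [hFF]
    _ = ‖∫ z, ∫ p, G p z ∂ν ∂(μ.prod μ)‖ₑ := by rw [integral_integral_swap hGint]
    _ ≤ ∫⁻ z, ‖∫ p, G p z ∂ν‖ₑ ∂(μ.prod μ) := enorm_integral_le_lintegral_enorm _
    _ = _ := by
      congr 1; ext z
      simp only [hG]
      rw [integral_const_mul, enorm_mul, enorm_mul]
      congr 2
      rw [← ofReal_norm, RCLike.norm_conj, ofReal_norm]

lemma ennreal_mul_le_sq_add (a b : ℝ≥0∞) : a * b ≤ a ^ 2 + b ^ 2 := by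
  rcases le_total a b with h | h
  · calc a * b ≤ b * b := by gcongr
      _ = b ^ 2 := by ring
      _ ≤ _ := le_add_self
  · calc a * b ≤ a * a := by gcongr
      _ = a ^ 2 := by ring
      _ ≤ _ := le_self_add

lemma schur_bound {Y : Type*} [MeasurableSpace Y] (μ : Measure Y) [SigmaFinite μ]
    (a : Y → ℝ≥0∞) (ha : Measurable a) (K : Y × Y → ℝ≥0∞) (hK : Measurable K)
    (hsymm : ∀ y y', K (y, y') = K (y', y)) (S : Set Y) (hS : MeasurableSet S)
    (haS : ∀ y, y ∉ S → a y = 0) (A : ℝ≥0∞)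
    (hA : ∀ y, ∫⁻ y', S.indicator (fun y' => K (y, y')) y' ∂μ ≤ A) :
    ∫⁻ z : Y × Y, a z.1 * a z.2 * K z ∂(μ.prod μ) ≤ 2 * A * ∫⁻ y, a y ^ 2 ∂μ := by
  have hI : Measurable (fun z : Y × Y => S.indicator (fun _ => (1 : ℝ≥0∞)) z.2) :=
    (measurable_const.indicator hS).comp measurable_snd
  have hI' : Measurable (fun z : Y × Y => S.indicator (fun _ => (1 : ℝ≥0∞)) z.1) :=
    (measurable_const.indicator hS).comp measurable_fst
  have key : ∀ y, ∫⁻ y', S.indicator (fun _ => (1 : ℝ≥0∞)) y' * K (y, y') ∂μ ≤ A := by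
    intro y
    refine le_trans (le_of_eq ?_) (hA y)
    congr 1; ext y'
    by_cases h : y' ∈ S <;> simp [h]
  have h1 : ∫⁻ z : Y × Y, a z.1 ^ 2 * (S.indicator (fun _ => (1 : ℝ≥0∞)) z.2 * K z) ∂(μ.prod μ)
      ≤ A * ∫⁻ y, a y ^ 2 ∂μ := by
    rw [lintegral_prod _ (by fun_prop)]
    calc _ = ∫⁻ y, a y ^ 2 * ∫⁻ y', S.indicator (fun _ => (1 : ℝ≥0∞)) y' * K (y, y') ∂μ ∂μ := by
          congr 1; ext y
          dsimp only
          rw [lintegral_const_mul]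
          exact (hI.mul hK).comp measurable_prodMk_left
      _ ≤ ∫⁻ y, a y ^ 2 * A ∂μ := by gcongr with y; exact key y
      _ = _ := by rw [lintegral_mul_const _ (by fun_prop), mul_comm]
  have h2 : ∫⁻ z : Y × Y, a z.2 ^ 2 * (S.indicator (fun _ => (1 : ℝ≥0∞)) z.1 * K z) ∂(μ.prod μ)
      ≤ A * ∫⁻ y, a y ^ 2 ∂μ := by
    rw [← lintegral_prod_swap]
    refine le_trans (le_of_eq ?_) h1
    congr 1; ext z
    simp only [Prod.fst_swap, Prod.snd_swap]
    rw [show K z.swap = K z from hsymm _ _]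
  calc ∫⁻ z : Y × Y, a z.1 * a z.2 * K z ∂(μ.prod μ)
      ≤ ∫⁻ z : Y × Y, (a z.1 ^ 2 * (S.indicator (fun _ => (1 : ℝ≥0∞)) z.2 * K z) + 
        a z.2 ^ 2 * (S.indicator (fun _ => (1 : ℝ≥0∞)) z.1 * K z)) ∂(μ.prod μ) := by
        gcongr with z
        by_cases h1 : z.1 ∈ S
        · by_cases h2 : z.2 ∈ S
          · simp only [h1, h2, Set.indicator_of_mem, one_mul, ← add_mul]
            gcongr
            exact ennreal_mul_le_sq_add _ _
          · simp [haS _ h2]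
        · simp [haS _ h1]
    _ ≤ A * ∫⁻ y, a y ^ 2 ∂μ + A * ∫⁻ y, a y ^ 2 ∂μ := by
        rw [lintegral_add_left (by fun_prop)]
        exact add_le_add h1 h2
    _ = _ := by ring

/-- the constant `∑ 3/(1+n²)` over the integers -/
def sumC : ℝ≥0∞ := ∑' n : ℤ, ENNReal.ofReal (3 / (1 + (n : ℝ) ^ 2))

lemma sumC_ne_top : sumC ≠ ⊤ := by
  have : Summable (fun n : ℤ => 3 / (1 + (n : ℝ) ^ 2)) := by
    have h := (Real.summable_one_div_int_pow (p := 2)).mpr (by norm_num)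
    have h3 := h.mul_left 3
    refine Summable.of_norm_bounded_eventually h3 ?_
    filter_upwards [(Set.finite_singleton (0:ℤ)).compl_mem_cofinite] with n hn
    have hn : (n:ℝ) ≠ 0 := by simpa using hn
    have : 0 < (n:ℝ)^2 := by positivity
    rw [Real.norm_of_nonneg (by positivity), mul_one_div]
    gcongr
    linarith
  exact this.tsum_ofReal_ne_top

lemma exp_neg_sq_le (x : ℝ) : Real.exp (-x ^ 2) ≤ 3 / (1 + (⌊x⌋ : ℝ) ^ 2) := by
  have h1 : Real.exp (-x ^ 2) ≤ 1 / (1 + x ^ 2) := by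
    rw [Real.exp_neg, ← one_div]
    gcongr
    linarith [Real.add_one_le_exp (x ^ 2)]
  refine h1.trans ?_
  rw [div_le_div_iff₀ (by positivity) (by positivity)]
  have h2 := Int.floor_le x
  have h3 := Int.lt_floor_add_one x
  nlinarith [sq_nonneg ((⌊x⌋ : ℝ) - 2 * x), sq_nonneg (⌊x⌋ - x : ℝ), sq_nonneg x]

/-- Level set estimate to Gaussian integral. -/
lemma gauss_level {X : Type*} [MeasurableSpace X] (μ : Measure X) (φ : X → ℝ) (hφ : Measurable φ)
    (S : Set X) (hS : MeasurableSet S) (η : ℝ) (hη : 0 < η) (B : ℝ≥0∞)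
    (hB : ∀ a : ℝ, μ (S ∩ {x | a ≤ φ x ∧ φ x < a + η}) ≤ B) (c : ℝ) :
    ∫⁻ x, S.indicator (fun x => ENNReal.ofReal (Real.exp (-((φ x - c) / η) ^ 2))) x ∂μ ≤ sumC * B := by
  have hE : ∀ n : ℤ, MeasurableSet (S ∩ {x | c + n * η ≤ φ x ∧ φ x < c + n * η + η}) := fun n =>
    hS.inter ((measurableSet_le measurable_const hφ).inter (measurableSet_lt hφ measurable_const))
  calc _ ≤ ∫⁻ x, ∑' n : ℤ, (S ∩ {x | c + n * η ≤ φ x ∧ φ x < c + n * η + η}).indicator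
        (fun _ => ENNReal.ofReal (3 / (1 + (n : ℝ) ^ 2))) x ∂μ := by
        gcongr with x
        by_cases hx : x ∈ S
        · refine le_trans ?_ (ENNReal.le_tsum ⌊(φ x - c) / η⌋)
          rw [Set.indicator_of_mem hx, Set.indicator_of_mem]
          · exact ENNReal.ofReal_le_ofReal (exp_neg_sq_le _)
          · refine ⟨hx, ?_⟩
            have h2 := Int.floor_le ((φ x - c) / η)
            have h3 := Int.lt_floor_add_one ((φ x - c) / η)
            rw [le_div_iff₀ hη] at h2
            rw [div_lt_iff₀ hη] at h3
            constructor <;> linarith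
        · simp [hx]
    _ = ∑' n : ℤ, ENNReal.ofReal (3 / (1 + (n : ℝ) ^ 2)) * μ (S ∩ {x | c + n * η ≤ φ x ∧ φ x < c + n * η + η}) := by
        rw [lintegral_tsum fun n => (measurable_const.indicator (hE n)).aemeasurable]
        congr 1; ext n
        rw [lintegral_indicator_const (hE n)]
    _ ≤ ∑' n : ℤ, ENNReal.ofReal (3 / (1 + (n : ℝ) ^ 2)) * B := by
        gcongr with n; exact hB _
    _ = _ := by rw [ENNReal.tsum_mul_right]; rfl

lemma gauss1 (ε : ℝ) (hε : 0 < ε) (s : ℝ) :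
    ∫ x : ℝ, (Real.exp (-ε * x ^ 2) : ℂ) * Complex.exp (Complex.I * ((x * s : ℝ) : ℂ)) =
      ((Real.sqrt (Real.pi / ε) * Real.exp (-s ^ 2 / (4 * ε)) : ℝ) : ℂ) := by
  have h := fourierIntegral_gaussian (b := (ε : ℂ)) (by simpa using hε) (s : ℂ)
  have h2 : ((Real.pi : ℂ) / (ε : ℂ)) ^ (1 / 2 : ℂ) = ((Real.sqrt (Real.pi / ε) : ℝ) : ℂ) := by
    rw [Real.sqrt_eq_rpow, Complex.ofReal_cpow (by positivity)]
    push_cast; rfl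
  rw [h2] at h
  push_cast
  rw [← h]
  congr 1; ext x
  rw [mul_comm]
  congr 2
  ring

def gD (ε : ℝ) {m : ℕ} (x : Fin m → ℝ) : ℝ := Real.exp (-ε * ∑ i, x i ^ 2)

def nuX (ε : ℝ) (m : ℕ) : Measure (Fin m → ℝ) := volume.withDensity (fun x => ENNReal.ofReal (gD ε x))

def nuT (ε : ℝ) : Measure ℝ := volume.withDensity (fun x => ENNReal.ofReal (Real.exp (-ε * x ^ 2)))

lemma gD_measurable (ε : ℝ) (m : ℕ) : Measurable (fun x : Fin m → ℝ => gD ε x) := by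
  unfold gD; fun_prop

lemma nuT_fin (ε : ℝ) (hε : 0 < ε) : IsFiniteMeasure (nuT ε) := by
  refine isFiniteMeasure_withDensity_ofReal ?_
  exact (integrable_exp_neg_mul_sq hε).2

lemma gD_eq (ε : ℝ) {m : ℕ} (x : Fin m → ℝ) : gD ε x = ∏ i, Real.exp (-ε * x i ^ 2) := by
  unfold gD
  rw [Finset.mul_sum, Real.exp_sum]

lemma nuX_fin (ε : ℝ) (hε : 0 < ε) (m : ℕ) : IsFiniteMeasure (nuX ε m) := by
  refine isFiniteMeasure_withDensity_ofReal ?_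
  have : Integrable (fun x : Fin m → ℝ => ∏ i, Real.exp (-ε * x i ^ 2)) :=
    Integrable.fintype_prod (f := fun _ : Fin m => fun x : ℝ => Real.exp (-ε * x ^ 2))
      (fun i => integrable_exp_neg_mul_sq hε)
  have e : (fun x : Fin m → ℝ => gD ε x) = (fun x : Fin m → ℝ => ∏ i, Real.exp (-ε * x i ^ 2)) := by
    ext x; exact gD_eq ε x
  exact (e ▸ this : Integrable (fun x : Fin m → ℝ => gD ε x)).2

lemma kerT (ε : ℝ) (hε : 0 < ε) (s : ℝ) :
    ∫ x, Complex.exp (Complex.I * ((x * s : ℝ) : ℂ)) ∂(nuT ε) =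
      ((Real.sqrt (Real.pi / ε) * Real.exp (-s ^ 2 / (4 * ε)) : ℝ) : ℂ) := by
  unfold nuT
  rw [integral_withDensity_eq_integral_toReal_smul (by fun_prop) (by simp), ← gauss1 ε hε]
  congr 1; ext x
  rw [ENNReal.toReal_ofReal (by positivity)]
  simp

lemma kerX (ε : ℝ) (hε : 0 < ε) {m : ℕ} (s : Fin m → ℝ) :
    ∫ x, Complex.exp (Complex.I * ((∑ i, x i * s i : ℝ) : ℂ)) ∂(nuX ε m) =
      ((∏ i, (Real.sqrt (Real.pi / ε) * Real.exp (-s i ^ 2 / (4 * ε))) : ℝ) : ℂ) := by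
  unfold nuX
  rw [integral_withDensity_eq_integral_toReal_smul ((gD_measurable ε m).ennreal_ofReal) (by simp)]
  have e : ∀ x : Fin m → ℝ, (ENNReal.ofReal (gD ε x)).toReal • Complex.exp (Complex.I * ((∑ i, x i * s i : ℝ) : ℂ))
      = ∏ i, ((Real.exp (-ε * x i ^ 2) : ℂ) * Complex.exp (Complex.I * ((x i * s i : ℝ) : ℂ))) := by
    intro x
    rw [ENNReal.toReal_ofReal (by unfold gD; positivity), gD_eq, Finset.prod_mul_distrib, ← Complex.exp_sum]
    simp [Finset.mul_sum]
  simp_rw [e]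
  rw [volume_pi, integral_fintype_prod_eq_prod (f := fun i => fun x : ℝ => (Real.exp (-ε * x ^ 2) : ℂ) * Complex.exp (Complex.I * ((x * s i : ℝ) : ℂ)))]
  rw [Complex.ofReal_prod]
  exact Finset.prod_congr rfl fun i _ => gauss1 ε hε (s i)

lemma kerY1 (lam : ℝ) (hl : 1 ≤ lam) (L : ℤ) :
    ∫ y in Set.Icc (0:ℝ) (2 * Real.pi * lam), Complex.exp (Complex.I * ((y * (L / lam) : ℝ) : ℂ)) =
      ((if L = 0 then 2 * Real.pi * lam else 0 : ℝ) : ℂ) := by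
  have hpos : 0 ≤ 2 * Real.pi * lam := by positivity
  rw [integral_Icc_eq_integral_Ioc, ← intervalIntegral.integral_of_le hpos]
  split_ifs with h
  · simp [h]
  · have hc : (Complex.I * ((L / lam : ℝ) : ℂ)) ≠ 0 := by
      have : (L : ℝ) / lam ≠ 0 := by
        have : (L : ℝ) ≠ 0 := by exact_mod_cast h
        positivity
      exact mul_ne_zero Complex.I_ne_zero (by exact_mod_cast this)
    have e : ∀ y : ℝ, Complex.exp (Complex.I * ((y * (L / lam) : ℝ) : ℂ)) =
        Complex.exp ((Complex.I * ((L / lam : ℝ) : ℂ)) * y) := by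
      intro y; congr 1; push_cast; ring
    simp_rw [e]
    rw [integral_exp_mul_complex hc]
    have : Complex.I * ((L / lam : ℝ) : ℂ) * ((2 * Real.pi * lam : ℝ) : ℂ) = L * (2 * Real.pi * Complex.I) := by
      have : (lam : ℂ) ≠ 0 := by
        have : lam ≠ 0 := by positivity
        exact_mod_cast this
      push_cast; field_simp
    rw [this, Complex.exp_int_mul_two_pi_mul_I]
    simp

lemma kerY (lam : ℝ) (hl : 1 ≤ lam) {n : ℕ} (L : Fin n → ℤ) :
    ∫ y in torusBox lam n, Complex.exp (Complex.I * ((∑ i, y i * (L i / lam) : ℝ) : ℂ)) =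
      ((if L = 0 then (2 * Real.pi * lam) ^ n else 0 : ℝ) : ℂ) := by
  have hb : torusBox lam n = Set.univ.pi (fun _ : Fin n => Set.Icc (0:ℝ) (2 * Real.pi * lam)) := by
    unfold torusBox
    rw [← Set.pi_univ_Icc]; rfl
  rw [hb, volume_pi, Measure.restrict_pi_pi]
  have e : ∀ y : Fin n → ℝ, Complex.exp (Complex.I * ((∑ i, y i * (L i / lam) : ℝ) : ℂ)) =
     ∏ i, Complex.exp (Complex.I * ((y i * (L i / lam) : ℝ) : ℂ)) := by
    intro y
    rw [← Complex.exp_sum]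
    push_cast
    rw [Finset.mul_sum]
  simp_rw [e]
  rw [integral_fintype_prod_eq_prod (f := fun i => fun y : ℝ => Complex.exp (Complex.I * ((y * (L i / lam) : ℝ) : ℂ)))]
  simp_rw [kerY1 lam hl]
  rw [← Complex.ofReal_prod]
  congr 1
  split_ifs with h
  · simp [h]
  · obtain ⟨i, hi⟩ := Function.ne_iff.mp h
    exact Finset.prod_eq_zero (Finset.mem_univ i) (if_neg hi)

/-- the weighted measure on space-time -/
def nuP (δ ε lam : ℝ) (m n : ℕ) : Measure (ℝ × ((Fin m → ℝ) × (Fin n → ℝ))) :=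
  (nuT δ).prod ((nuX ε m).prod (volume.restrict (torusBox lam n)))

lemma torusBox_fin (lam : ℝ) (n : ℕ) : IsFiniteMeasure ((volume : Measure (Fin n → ℝ)).restrict (torusBox lam n)) :=
  ⟨by
    rw [Measure.restrict_apply_univ]
    exact (isCompact_Icc).measure_lt_top⟩

lemma nuP_fin (δ ε lam : ℝ) (hδ : 0 < δ) (hε : 0 < ε) (m n : ℕ) : IsFiniteMeasure (nuP δ ε lam m n) := by
  have := nuT_fin δ hδ
  have := nuX_fin ε hε m
  have := torusBox_fin lam n
  unfold nuP; infer_instance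

lemma kerP (δ ε lam : ℝ) (hδ : 0 < δ) (hε : 0 < ε) (hl : 1 ≤ lam) {m n : ℕ} (s : ℝ) (ξ : Fin m → ℝ) (L : Fin n → ℤ) :
    ∫ p, Complex.exp (Complex.I * ((p.1 * s + (∑ i, p.2.1 i * ξ i + ∑ i, p.2.2 i * (L i / lam)) : ℝ) : ℂ)) ∂(nuP δ ε lam m n) =
      (((Real.sqrt (Real.pi / δ) * Real.exp (-s ^ 2 / (4 * δ))) *
       ((∏ i, (Real.sqrt (Real.pi / ε) * Real.exp (-ξ i ^ 2 / (4 * ε)))) *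
        (if L = 0 then (2 * Real.pi * lam) ^ n else 0)) : ℝ) : ℂ) := by
  have := nuT_fin δ hδ
  have := nuX_fin ε hε m
  have := torusBox_fin lam n
  rw [Complex.ofReal_mul (Real.sqrt (Real.pi / δ) * _) _, Complex.ofReal_mul (∏ i, _) _, ← kerY lam hl, ← kerX ε hε, ← kerT δ hδ, ← integral_prod_mul, ← integral_prod_mul]
  unfold nuP
  congr 1; ext p
  rw [← Complex.exp_add, ← Complex.exp_add]
  congr 1
  push_cast; ring

abbrev XX (m n : ℕ) := (Fin n → ℤ) × (Fin m → ℝ)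

def muX (m n : ℕ) : Measure (XX m n) := (Measure.count).prod volume

instance (m n : ℕ) : SigmaFinite (muX m n) := by unfold muX; infer_instance

instance (m n : ℕ) : (muX m n).IsAddRightInvariant := by unfold muX; infer_instance

instance (m n : ℕ) : (muX m n).IsAddLeftInvariant := by unfold muX; infer_instance

def phi (lam : ℝ) {m n : ℕ} (k : XX m n) : ℝ := (∑ i, (k.2 i) ^ 2) + ∑ i, ((k.1 i : ℝ) / lam) ^ 2

lemma phi_meas (lam : ℝ) (m n : ℕ) : Measurable (fun k : XX m n => phi lam k) := by
  have h : ∀ i : Fin n, Measurable (fun k : XX m n => ((k.1 i : ℤ) : ℝ)) := fun i =>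
    (measurable_from_top (f := fun z : ℤ => (z : ℝ))).comp ((measurable_pi_apply i).comp measurable_fst)
  unfold phi
  fun_prop

def regA (lam N : ℝ) (m n : ℕ) : Set (XX m n) :=
  {k | freqNorm lam k.2 k.1 ≤ 2 * N ∧ (1 < N → N / 2 ≤ freqNorm lam k.2 k.1)}

lemma regA_meas (lam N : ℝ) (m n : ℕ) : MeasurableSet (regA lam N m n) := by
  have h : Measurable (fun k : XX m n => freqNorm lam k.2 k.1) := (phi_meas lam m n).sqrt
  refine (measurableSet_le h measurable_const).inter ?_
  by_cases h1 : 1 < N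
  · simp only [h1, true_imp_iff]
    exact measurableSet_le measurable_const h
  · simp only [h1, false_imp_iff]
    exact MeasurableSet.univ

def th (lam : ℝ) {m n : ℕ} (p : ℝ × ((Fin m → ℝ) × (Fin n → ℝ))) (k : XX m n) : ℝ :=
  ((∑ i, p.2.1 i * k.2 i) + ∑ i, p.2.2 i * ((k.1 i : ℝ) / lam)) - p.1 * phi lam k

lemma th_meas (lam : ℝ) (m n : ℕ) : Measurable (fun q : (ℝ × ((Fin m → ℝ) × (Fin n → ℝ))) × XX m n => th lam q.1 q.2) := by
  have h : ∀ i : Fin n, Measurable (fun k : (ℝ × ((Fin m → ℝ) × (Fin n → ℝ))) × XX m n => ((k.2.1 i : ℤ) : ℝ)) := fun i =>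
    (measurable_from_top (f := fun z : ℤ => (z : ℝ))).comp ((measurable_pi_apply i).comp (measurable_fst.comp measurable_snd))
  have h2 : Measurable (fun k : (ℝ × ((Fin m → ℝ) × (Fin n → ℝ))) × XX m n => phi lam k.2) := (phi_meas lam m n).comp measurable_snd
  unfold th
  fun_prop

def Tp (δ s : ℝ) : ℝ := Real.sqrt (Real.pi / δ) * Real.exp (-s ^ 2 / (4 * δ))

def Xp (ε : ℝ) {m : ℕ} (ξ : Fin m → ℝ) : ℝ := ∏ i, (Real.sqrt (Real.pi / ε) * Real.exp (-ξ i ^ 2 / (4 * ε)))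

def Yp (lam : ℝ) {n : ℕ} (L : Fin n → ℤ) : ℝ := if L = 0 then (2 * Real.pi * lam) ^ n else 0

lemma Tp_meas (δ : ℝ) : Measurable (Tp δ) := by unfold Tp; fun_prop
lemma Xp_meas (ε : ℝ) (m : ℕ) : Measurable (Xp ε : (Fin m → ℝ) → ℝ) := by unfold Xp; fun_prop
lemma Yp_meas (lam : ℝ) (n : ℕ) : Measurable (Yp lam : (Fin n → ℤ) → ℝ) := measurable_of_countable _

lemma Tp_nonneg (δ s : ℝ) : 0 ≤ Tp δ s := by unfold Tp; positivity
lemma Xp_nonneg (ε : ℝ) {m : ℕ} (ξ : Fin m → ℝ) : 0 ≤ Xp ε ξ := by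
  unfold Xp; exact Finset.prod_nonneg fun i _ => by positivity
lemma Yp_nonneg (lam : ℝ) (hl : 1 ≤ lam) {n : ℕ} (L : Fin n → ℤ) : 0 ≤ Yp lam L := by
  unfold Yp; split_ifs <;> positivity

/-- Total mass of the spatial kernel. -/
lemma lint_Xp (ε : ℝ) (hε : 0 < ε) (m : ℕ) :
    ∫⁻ ξ : Fin m → ℝ, ENNReal.ofReal (Xp ε ξ) = ENNReal.ofReal ((2 * Real.pi) ^ m) := by
  have hi : Integrable (fun x : ℝ => Real.sqrt (Real.pi / ε) * Real.exp (-x ^ 2 / (4 * ε))) := by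
    have := (integrable_exp_neg_mul_sq (b := 1 / (4 * ε)) (by positivity)).const_mul (Real.sqrt (Real.pi / ε))
    refine this.congr (Filter.Eventually.of_forall fun x => ?_)
    simp only
    congr 2; ring
  have hI : Integrable (fun ξ : Fin m → ℝ => Xp ε ξ) := by
    unfold Xp
    exact Integrable.fintype_prod (f := fun _ : Fin m => fun x : ℝ => Real.sqrt (Real.pi / ε) * Real.exp (-x ^ 2 / (4 * ε))) (fun _ => hi)
  have h1 : ∫ x : ℝ, Real.sqrt (Real.pi / ε) * Real.exp (-x ^ 2 / (4 * ε)) = 2 * Real.pi := by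
    rw [integral_const_mul]
    have : ∀ x : ℝ, Real.exp (-x ^ 2 / (4 * ε)) = Real.exp (-(1 / (4 * ε)) * x ^ 2) := by
      intro x; congr 1; ring
    simp_rw [this]
    rw [integral_gaussian, ← Real.sqrt_mul (by positivity)]
    have : Real.pi / ε * (Real.pi / (1 / (4 * ε))) = (2 * Real.pi) ^ 2 := by field_simp; ring
    rw [this, Real.sqrt_sq (by positivity)]
  rw [← ofReal_integral_eq_lintegral_ofReal hI (Filter.Eventually.of_forall fun _ => Xp_nonneg _ _)]
  congr 1
  unfold Xp
  rw [volume_pi, integral_fintype_prod_eq_prod (f := fun _ : Fin m => fun x : ℝ => Real.sqrt (Real.pi / ε) * Real.exp (-x ^ 2 / (4 * ε)))]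
  simp [h1]

lemma lint_XpYp (ε lam : ℝ) (hε : 0 < ε) (hl : 1 ≤ lam) (m n : ℕ) (K : XX m n) :
    ∫⁻ k, ENNReal.ofReal (Xp ε (K.2 - k.2) * Yp lam (K.1 - k.1)) ∂(muX m n) =
      ENNReal.ofReal ((2 * Real.pi) ^ m * (2 * Real.pi * lam) ^ n) := by
  have hX := Xp_meas ε m
  have hY := Yp_meas lam n
  unfold muX
  rw [lintegral_prod _ (by fun_prop), lintegral_count]
  dsimp only
  rw [tsum_eq_single K.1]
  · have e : ∀ x, ENNReal.ofReal (Xp ε (K.2 - x) * Yp lam (K.1 - K.1)) = 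
      ENNReal.ofReal (Xp ε (K.2 - x)) * ENNReal.ofReal ((2 * Real.pi * lam) ^ n) := by
      intro x
      rw [← ENNReal.ofReal_mul (Xp_nonneg _ _)]
      simp [Yp]
    simp_rw [e]
    rw [lintegral_mul_const _ (by fun_prop), lintegral_sub_left_eq_self (fun x => ENNReal.ofReal (Xp ε x)), lint_Xp ε hε,
      ENNReal.ofReal_mul (by positivity)]
  · intro l hl
    have : K.1 - l ≠ 0 := sub_ne_zero.mpr (Ne.symm hl)
    simp [Yp, this]

def levelS (lam N₁ N₂ : ℝ) {m n : ℕ} (K : XX m n) : Set (XX m n) :=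
  {k | K - k ∈ regA lam N₁ m n ∧ k ∈ regA lam N₂ m n}

lemma levelS_meas (lam N₁ N₂ : ℝ) {m n : ℕ} (K : XX m n) : MeasurableSet (levelS lam N₁ N₂ K) := by
  have h : Measurable (fun k : XX m n => K - k) := by fun_prop
  exact (h (regA_meas lam N₁ m n)).inter (regA_meas lam N₂ m n)

def Kc (m n : ℕ) : ℝ := 2 * ((2 * Real.pi) ^ m * (2 * Real.pi) ^ n * (2 * Real.sqrt Real.pi * sumC.toReal))

lemma Kc_nonneg (m n : ℕ) : 0 ≤ Kc m n := by unfold Kc; positivity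

lemma core_schur (lam N₁ N₂ η ε B : ℝ) (hl : 1 ≤ lam) (hη : 0 < η) (hε : 0 < ε) (hB0 : 0 ≤ B) {m n : ℕ}
    (hB : ∀ (K : XX m n) (a : ℝ), muX m n (levelS lam N₁ N₂ K ∩
      {k | a ≤ phi lam (K - k) + phi lam k ∧ phi lam (K - k) + phi lam k < a + η}) ≤ ENNReal.ofReal (lam ^ n * B * η))
    (y : XX m n × XX m n) :
    ∫⁻ y', (Set.indicator (regA lam N₁ m n ×ˢ regA lam N₂ m n) (fun y' : XX m n × XX m n =>
      ENNReal.ofReal (Tp (η ^ 2 / 4) ((phi lam y'.1 + phi lam y'.2) - (phi lam y.1 + phi lam y.2)) *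
        (Xp ε ((y.1 + y.2).2 - (y'.1 + y'.2).2) * Yp lam ((y.1 + y.2).1 - (y'.1 + y'.2).1)))) y')
        ∂((muX m n).prod (muX m n)) ≤
     ENNReal.ofReal ((2 * Real.pi) ^ m * (2 * Real.pi * lam) ^ n * (2 * Real.sqrt Real.pi * sumC.toReal) * (lam ^ n * B)) := by
  set c := phi lam y.1 + phi lam y.2
  set Q := y.1 + y.2
  have hX := Xp_meas ε m
  have hY := Yp_meas lam n
  have hT := Tp_meas (η ^ 2 / 4)
  have hphi := phi_meas lam m n
  set f : XX m n × XX m n → ℝ≥0∞ := (Set.indicator (regA lam N₁ m n ×ˢ regA lam N₂ m n) (fun y' : XX m n × XX m n =>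
      ENNReal.ofReal (Tp (η ^ 2 / 4) ((phi lam y'.1 + phi lam y'.2) - c) *
        (Xp ε (Q.2 - (y'.1 + y'.2).2) * Yp lam (Q.1 - (y'.1 + y'.2).1))))) with hf
  have hfm : Measurable f := by
    refine Measurable.indicator ?_ ((regA_meas lam N₁ m n).prod (regA_meas lam N₂ m n))
    simp only [Prod.fst_add, Prod.snd_add]
    fun_prop
  rw [lintegral_prod_symm _ hfm.aemeasurable]
  have e1 : ∀ k₂, ∫⁻ k₁, f (k₁, k₂) ∂(muX m n) = ∫⁻ K, f (K - k₂, k₂) ∂(muX m n) := by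
    intro k₂
    rw [lintegral_sub_right_eq_self (fun k₁ => f (k₁, k₂))]
  simp_rw [e1]
  rw [lintegral_lintegral_swap (by
    apply Measurable.aemeasurable
    unfold Function.uncurry
    exact hfm.comp (by fun_prop : Measurable (fun a : XX m n × XX m n => (a.2 - a.1, a.1))))]
  have e2 : ∀ K : XX m n, ∫⁻ k₂, f (K - k₂, k₂) ∂(muX m n) ≤ 
      ENNReal.ofReal (Xp ε (Q.2 - K.2) * Yp lam (Q.1 - K.1)) * ENNReal.ofReal (2 * Real.sqrt Real.pi * sumC.toReal * (lam ^ n * B)) := by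
    intro K
    have hg := gauss_level (muX m n) (fun k => phi lam (K - k) + phi lam k) (by fun_prop) (levelS lam N₁ N₂ K)
      (levelS_meas lam N₁ N₂ K) η hη _ (hB K) c
    have e3 : ∀ k₂, f (K - k₂, k₂) = ENNReal.ofReal (Xp ε (Q.2 - K.2) * Yp lam (Q.1 - K.1)) * (ENNReal.ofReal (2 * Real.sqrt Real.pi / η) *
        (levelS lam N₁ N₂ K).indicator (fun x => ENNReal.ofReal (Real.exp (-((phi lam (K - x) + phi lam x - c) / η) ^ 2))) k₂) := by
      intro k₂
      by_cases hk : k₂ ∈ levelS lam N₁ N₂ K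
      · rw [Set.indicator_of_mem hk, hf, Set.indicator_of_mem (Set.mk_mem_prod hk.1 hk.2),
          ← ENNReal.ofReal_mul (by positivity), ← ENNReal.ofReal_mul (mul_nonneg (Xp_nonneg _ _) (Yp_nonneg _ hl _))]
        simp only [sub_add_cancel]
        rw [mul_comm]
        congr 2
        unfold Tp
        have a1 : Real.sqrt (Real.pi / (η ^ 2 / 4)) = 2 * Real.sqrt Real.pi / η := by
          rw [show Real.pi / (η ^ 2 / 4) = (2 / η) ^ 2 * Real.pi by field_simp; ring, Real.sqrt_mul (by positivity),
            Real.sqrt_sq (by positivity)]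
          ring
        rw [a1]
        congr 2
        field_simp
      · rw [Set.indicator_of_notMem hk, hf, Set.indicator_of_notMem]
        · simp
        · intro h; exact hk h
    simp_rw [e3]
    have hm2 : Measurable ((levelS lam N₁ N₂ K).indicator (fun x => ENNReal.ofReal (Real.exp (-((phi lam (K - x) + phi lam x - c) / η) ^ 2)))) := by
      refine Measurable.indicator ?_ (levelS_meas lam N₁ N₂ K)
      fun_prop
    rw [lintegral_const_mul _ (hm2.const_mul _), lintegral_const_mul _ hm2]
    gcongr
    calc _ ≤ ENNReal.ofReal (2 * Real.sqrt Real.pi / η) * (sumC * ENNReal.ofReal (lam ^ n * B * η)) := by gcongr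
      _ = _ := by
        rw [← ENNReal.ofReal_toReal sumC_ne_top, ← ENNReal.ofReal_mul (by positivity), ← ENNReal.ofReal_mul (by positivity)]
        rw [ENNReal.toReal_ofReal (by positivity)]
        congr 1
        field_simp
  calc _ ≤ ∫⁻ K, ENNReal.ofReal (Xp ε (Q.2 - K.2) * Yp lam (Q.1 - K.1)) * ENNReal.ofReal (2 * Real.sqrt Real.pi * sumC.toReal * (lam ^ n * B)) ∂(muX m n) := by
        gcongr with K; exact e2 K
    _ = _ := by
      rw [lintegral_mul_const _ (by fun_prop), lint_XpYp ε lam hε hl, ← ENNReal.ofReal_mul (by positivity)]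
      congr 1; ring

lemma core_bound (lam N₁ N₂ η ε B : ℝ) (hl : 1 ≤ lam) (hη : 0 < η) (hε : 0 < ε) (hB0 : 0 ≤ B) {m n : ℕ}
    (hB : ∀ (K : XX m n) (a : ℝ), muX m n (levelS lam N₁ N₂ K ∩
      {k | a ≤ phi lam (K - k) + phi lam k ∧ phi lam (K - k) + phi lam k < a + η}) ≤ ENNReal.ofReal (lam ^ n * B * η))
    (G₁ G₂ : XX m n → ℂ) (h₁ : Measurable G₁) (h₂ : Measurable G₂) (hi₁ : Integrable G₁ (muX m n))
    (hi₂ : Integrable G₂ (muX m n)) (hs₁ : ∀ k, k ∉ regA lam N₁ m n → G₁ k = 0) (hs₂ : ∀ k, k ∉ regA lam N₂ m n → G₂ k = 0) :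
    ∫⁻ p, ‖(∫ k, G₁ k * Complex.exp (Complex.I * (th lam p k : ℂ)) ∂(muX m n)) * 
      (∫ k, G₂ k * Complex.exp (Complex.I * (th lam p k : ℂ)) ∂(muX m n))‖ₑ ^ 2 ∂(nuP (η ^ 2 / 4) ε lam m n) ≤
    ENNReal.ofReal (Kc m n * B * lam ^ n * lam ^ n) * (∫⁻ k, ‖G₁ k‖ₑ ^ 2 ∂(muX m n)) * (∫⁻ k, ‖G₂ k‖ₑ ^ 2 ∂(muX m n)) := by
  have := nuP_fin (η ^ 2 / 4) ε lam (by positivity) hε m n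
  have hX := Xp_meas ε m
  have hY := Yp_meas lam n
  have hT := Tp_meas (η ^ 2 / 4)
  have hphi := phi_meas lam m n
  set h : XX m n × XX m n → ℂ := fun z => G₁ z.1 * G₂ z.2 with hh
  have hm : Measurable h := by fun_prop
  have hint : Integrable h ((muX m n).prod (muX m n)) := hi₁.mul_prod hi₂
  set θ : (ℝ × ((Fin m → ℝ) × (Fin n → ℝ))) → (XX m n × XX m n) → ℝ := fun p z => th lam p z.1 + th lam p z.2 with hθ
  have hθm : Measurable (Function.uncurry θ) := by
    unfold Function.uncurry
    exact ((th_meas lam m n).comp (by fun_prop : Measurable (fun q : (ℝ × ((Fin m → ℝ) × (Fin n → ℝ))) × (XX m n × XX m n) => (q.1, q.2.1)))).add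
      ((th_meas lam m n).comp (by fun_prop : Measurable (fun q : (ℝ × ((Fin m → ℝ) × (Fin n → ℝ))) × (XX m n × XX m n) => (q.1, q.2.2))))
  have e1 : ∀ p, (∫ k, G₁ k * Complex.exp (Complex.I * (th lam p k : ℂ)) ∂(muX m n)) * 
      (∫ k, G₂ k * Complex.exp (Complex.I * (th lam p k : ℂ)) ∂(muX m n)) =
      ∫ z, h z * Complex.exp (Complex.I * (θ p z : ℂ)) ∂((muX m n).prod (muX m n)) := by
    intro p
    rw [← integral_prod_mul]
    congr 1; ext z
    have : Complex.exp (Complex.I * (θ p z : ℂ)) = Complex.exp (Complex.I * (th lam p z.1 : ℂ)) * Complex.exp (Complex.I * (th lam p z.2 : ℂ)) := by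
      rw [← Complex.exp_add]; congr 1; simp only [hθ]; push_cast; ring
    rw [this]; simp only [hh]; ring
  simp_rw [e1]
  refine (expand_bound _ _ h hm hint θ hθm).trans ?_
  set K : (XX m n × XX m n) × (XX m n × XX m n) → ℝ≥0∞ := fun z =>
    ENNReal.ofReal (Tp (η ^ 2 / 4) ((phi lam z.2.1 + phi lam z.2.2) - (phi lam z.1.1 + phi lam z.1.2)) *
        (Xp ε ((z.1.1 + z.1.2).2 - (z.2.1 + z.2.2).2) * Yp lam ((z.1.1 + z.1.2).1 - (z.2.1 + z.2.2).1))) with hK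
  have e2 : ∀ z : (XX m n × XX m n) × (XX m n × XX m n), 
      ‖∫ p, Complex.exp (Complex.I * ((θ p z.1 - θ p z.2 : ℝ) : ℂ)) ∂(nuP (η ^ 2 / 4) ε lam m n)‖ₑ = K z := by
    intro z
    have := kerP (η ^ 2 / 4) ε lam (by positivity) hε hl ((phi lam z.2.1 + phi lam z.2.2) - (phi lam z.1.1 + phi lam z.1.2))
      ((z.1.1 + z.1.2).2 - (z.2.1 + z.2.2).2) ((z.1.1 + z.1.2).1 - (z.2.1 + z.2.2).1)
    have e3 : ∀ p : ℝ × ((Fin m → ℝ) × (Fin n → ℝ)), θ p z.1 - θ p z.2 = (p.1 * ((phi lam z.2.1 + phi lam z.2.2) - (phi lam z.1.1 + phi lam z.1.2)) + (∑ i, p.2.1 i * ((z.1.1 + z.1.2).2 - (z.2.1 + z.2.2).2) i 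
        + ∑ i, p.2.2 i * ((((z.1.1 + z.1.2).1 - (z.2.1 + z.2.2).1) i : ℤ) / lam))) := by
      intro p
      simp only [hθ, th, Prod.fst_add, Prod.snd_add, Pi.add_apply, Pi.sub_apply]
      push_cast
      simp only [mul_add, mul_sub, add_div, sub_div, Finset.sum_add_distrib, Finset.sum_sub_distrib]
      ring
    simp_rw [e3]
    rw [this, ← ofReal_norm, Complex.norm_real, Real.norm_of_nonneg]
    · rfl
    · exact mul_nonneg (Tp_nonneg _ _) (mul_nonneg (Xp_nonneg _ _) (Yp_nonneg _ hl _))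
  simp_rw [e2]
  have hKm : Measurable K := by
    simp only [hK, Prod.fst_add, Prod.snd_add]
    fun_prop
  have hTs : ∀ s, Tp (η ^ 2 / 4) (-s) = Tp (η ^ 2 / 4) s := by intro s; simp [Tp]
  have hXs : ∀ s : Fin m → ℝ, Xp ε (-s) = Xp ε s := by intro s; simp [Xp]
  have hYs : ∀ s : Fin n → ℤ, Yp lam (-s) = Yp lam s := by intro s; simp [Yp]
  have hsymm : ∀ y y', K (y, y') = K (y', y) := by
    intro y y'
    simp only [hK]
    rw [← hTs, ← hXs, ← hYs]
    simp only [neg_sub]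
  have := schur_bound ((muX m n).prod (muX m n)) (fun z => ‖h z‖ₑ) (by fun_prop) K hKm hsymm
    (regA lam N₁ m n ×ˢ regA lam N₂ m n) ((regA_meas lam N₁ m n).prod (regA_meas lam N₂ m n)) (by
      intro y hy
      simp only [hh]
      by_cases h1 : y.1 ∈ regA lam N₁ m n
      · by_cases h2 : y.2 ∈ regA lam N₂ m n
        · exact absurd ⟨h1, h2⟩ hy
        · simp [hs₂ _ h2]
      · simp [hs₁ _ h1]) _ (fun y => core_schur lam N₁ N₂ η ε B hl hη hε hB0 hB y)
  refine this.trans (le_of_eq ?_)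
  have e4 : ∫⁻ z, ‖h z‖ₑ ^ 2 ∂((muX m n).prod (muX m n)) = (∫⁻ k, ‖G₁ k‖ₑ ^ 2 ∂(muX m n)) * (∫⁻ k, ‖G₂ k‖ₑ ^ 2 ∂(muX m n)) := by
    rw [← lintegral_prod_mul (by fun_prop) (by fun_prop)]
    congr 1; ext z
    simp only [hh]
    rw [enorm_mul, mul_pow]
  rw [e4, ← mul_assoc]
  congr 2
  rw [show (2 : ℝ≥0∞) = ENNReal.ofReal 2 by simp, ← ENNReal.ofReal_mul (by norm_num)]
  congr 1
  unfold Kc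
  rw [mul_pow (2 * Real.pi) lam]
  ring

lemma l2sq_eq (lam : ℝ) {m n : ℕ} (G : XX m n → ℂ) (hG : Measurable G) :
    l2sq lam (fun ζ j => G (j, ζ)) = ENNReal.ofReal (1 / lam ^ n) * ∫⁻ k, ‖G k‖ₑ ^ 2 ∂(muX m n) := by
  unfold l2sq muX
  rw [lintegral_prod _ (by fun_prop), lintegral_count]
  rfl

lemma waveU_eq (lam : ℝ) {m n : ℕ} (G : XX m n → ℂ) (hG : Integrable G (muX m n))
    (p : ℝ × ((Fin m → ℝ) × (Fin n → ℝ))) :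
    waveU lam (fun ζ j => G (j, ζ)) p.1 p.2.1 p.2.2 =
      ((1 / lam ^ n : ℝ) : ℂ) * ∫ k, G k * Complex.exp (Complex.I * (th lam p k : ℂ)) ∂(muX m n) := by
  have hi : Integrable (fun k => G k * Complex.exp (Complex.I * (th lam p k : ℂ))) (muX m n) := by
    refine hG.mono ?_ ?_
    · have h := (th_meas lam m n).comp (measurable_prodMk_left (x := p))
      have h' : Measurable (fun k : XX m n => th lam p k) := h
      refine hG.1.mul ?_
      apply Measurable.aestronglyMeasurable
      fun_prop
    · refine Filter.Eventually.of_forall fun k => ?_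
      rw [norm_mul, mul_comm Complex.I, Complex.norm_exp_ofReal_mul_I, mul_one]
  unfold waveU
  congr 1
  unfold muX at hi ⊢
  rw [integral_prod _ hi, integral_countable hi.integral_prod_left]
  simp only [measureReal_def, Measure.count_singleton, ENNReal.toReal_one, one_smul]
  rfl

lemma reduce (lam N : ℝ) {m n : ℕ} (g : (Fin m → ℝ) → (Fin n → ℤ) → ℂ) (hs : SuppIn lam g N) :
    ∃ G : XX m n → ℂ, Measurable G ∧ (∀ k, k ∉ regA lam N m n → G k = 0) ∧
      (∀ t x y, waveU lam (fun ζ j => G (j, ζ)) t x y = waveU lam g t x y) ∧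
      l2sq lam (fun ζ j => G (j, ζ)) ≤ l2sq lam g := by
  let R : (Fin n → ℤ) → (Fin m → ℝ) → ℂ := fun j => 
    if h : AEStronglyMeasurable (fun ζ => g ζ j) volume then h.mk _ else 0
  have hR : ∀ j, Measurable (R j) := by
    intro j
    simp only [R]
    split_ifs with h
    · exact h.stronglyMeasurable_mk.measurable
    · exact measurable_const
  have hRm : Measurable (fun k : XX m n => R k.1 k.2) := by
    exact measurable_from_prod_countable_right (f := fun k : XX m n => R k.1 k.2) hR
  let G : XX m n → ℂ := (regA lam N m n).indicator (fun k => R k.1 k.2)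
  have hG1 : ∀ j, AEStronglyMeasurable (fun ζ => g ζ j) volume → (fun ζ => G (j, ζ)) =ᵐ[volume] (fun ζ => g ζ j) := by
    intro j hj
    filter_upwards [hj.ae_eq_mk] with ζ hζ
    by_cases hk : (j, ζ) ∈ regA lam N m n
    · simp only [G, Set.indicator_of_mem hk, R, hj, dif_pos]
      exact hζ.symm
    · simp only [G, Set.indicator_of_notMem hk]
      by_contra h
      exact hk (hs ζ j (Ne.symm h))
  have hG2 : ∀ j, ¬ AEStronglyMeasurable (fun ζ => g ζ j) volume → (fun ζ => G (j, ζ)) = 0 := by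
    intro j hj
    ext ζ
    by_cases hk : (j, ζ) ∈ regA lam N m n
    · simp [G, R, hj]
    · simp [G, hk]
  refine ⟨G, hRm.indicator (regA_meas lam N m n), fun k hk => Set.indicator_of_notMem hk _, ?_, ?_⟩
  · intro t x y
    unfold waveU
    congr 2
    ext j
    by_cases hj : AEStronglyMeasurable (fun ζ => g ζ j) volume
    · refine integral_congr_ae ?_
      filter_upwards [hG1 j hj] with ζ hζ
      rw [hζ]
    · have e : ∀ ζ, G (j, ζ) = 0 := fun ζ => congrFun (hG2 j hj) ζ
      simp only [e, zero_mul, integral_zero]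
      symm
      refine integral_undef fun hI => hj ?_
      set E : (Fin m → ℝ) → ℂ := fun ζ => Complex.exp (Complex.I *
      ((((∑ i, x i * ζ i) + ∑ i, y i * ((j i : ℝ) / lam))
        - t * ((∑ i, (ζ i) ^ 2) + ∑ i, ((j i : ℝ) / lam) ^ 2) : ℝ) : ℂ)) with hE
      have hEm : Measurable (fun ζ => (E ζ)⁻¹) := by simp only [hE]; fun_prop
      have := hI.1.mul hEm.aestronglyMeasurable
      refine this.congr (Filter.Eventually.of_forall fun ζ => ?_)
      have : E ζ ≠ 0 := Complex.exp_ne_zero _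
      simp only [Pi.mul_apply]
      exact mul_inv_cancel_right₀ this _
  · unfold l2sq
    refine mul_le_mul_right (ENNReal.tsum_le_tsum fun j => ?_) _
    by_cases hj : AEStronglyMeasurable (fun ζ => g ζ j) volume
    · refine le_of_eq (lintegral_congr_ae ?_)
      filter_upwards [hG1 j hj] with ζ hζ
      rw [hζ]
    · have e : ∀ ζ, G (j, ζ) = 0 := fun ζ => congrFun (hG2 j hj) ζ
      simp [e]

lemma waveU_zero_of_l2sq (lam : ℝ) (hl : 1 ≤ lam) {m n : ℕ} (G : XX m n → ℂ) (hG : Measurable G)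
    (h : l2sq lam (fun ζ j => G (j, ζ)) = 0) (t : ℝ) (x : Fin m → ℝ) (y : Fin n → ℝ) :
    waveU lam (fun ζ j => G (j, ζ)) t x y = 0 := by
  unfold l2sq at h
  have hp : ENNReal.ofReal (1 / lam ^ n) ≠ 0 := by
    simp; positivity
  have h2 := (mul_eq_zero.mp h).resolve_left hp
  rw [ENNReal.tsum_eq_zero] at h2
  unfold waveU
  have : ∀ j : Fin n → ℤ, (fun ζ => G (j, ζ)) =ᵐ[volume] 0 := by
    intro j
    have h3 := h2 j
    rw [lintegral_eq_zero_iff (by fun_prop)] at h3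
    filter_upwards [h3] with ζ hζ
    simpa using hζ
  rw [mul_eq_zero]; right
  convert tsum_zero with j
  refine integral_eq_zero_of_ae ?_
  filter_upwards [this j] with ζ hζ
  simp only [Pi.zero_apply] at hζ
  simp [hζ]

lemma regA_bounds (lam N : ℝ) (hl : 1 ≤ lam) {m n : ℕ} (k : XX m n) (hk : k ∈ regA lam N m n) :
    (∀ i, |(k.1 i : ℝ)| ≤ lam * (2 * N)) ∧ (∀ i, |k.2 i| ≤ 2 * N) := by
  have h1 : freqNorm lam k.2 k.1 ≤ 2 * N := hk.1
  have h0 : 0 ≤ 2 * N := le_trans (Real.sqrt_nonneg _) h1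
  unfold freqNorm at h1
  rw [Real.sqrt_le_left h0] at h1
  have hA : 0 ≤ ∑ i, (k.2 i) ^ 2 := Finset.sum_nonneg fun i _ => sq_nonneg _
  have hB : 0 ≤ ∑ i, ((k.1 i : ℝ) / lam) ^ 2 := Finset.sum_nonneg fun i _ => sq_nonneg _
  constructor
  · intro i
    have := Finset.single_le_sum (f := fun i => ((k.1 i : ℝ) / lam) ^ 2) (fun i _ => sq_nonneg _) (Finset.mem_univ i)
    have h2 : |(k.1 i : ℝ) / lam| ≤ 2 * N := abs_le_of_sq_le_sq (by linarith) h0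
    rw [abs_div, abs_of_pos (by positivity : 0 < lam), div_le_iff₀ (by positivity)] at h2
    linarith
  · intro i
    have := Finset.single_le_sum (f := fun i => (k.2 i) ^ 2) (fun i _ => sq_nonneg _) (Finset.mem_univ i)
    exact abs_le_of_sq_le_sq (by linarith) h0

lemma regA_fin (lam N : ℝ) (hl : 1 ≤ lam) (m n : ℕ) : muX m n (regA lam N m n) ≠ ⊤ := by
  have hsub : regA lam N m n ⊆ (Set.univ.pi fun _ : Fin n => Set.Icc (⌈-(lam * (2 * N))⌉) (⌊lam * (2 * N)⌋)) ×ˢ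
      (Set.Icc (fun _ => -(2 * N)) (fun _ => 2 * N)) := by
    intro k hk
    obtain ⟨h1, h2⟩ := regA_bounds lam N hl k hk
    refine ⟨?_, ?_⟩
    · intro i _
      have := abs_le.mp (h1 i)
      exact ⟨Int.ceil_le.mpr this.1, Int.le_floor.mpr this.2⟩
    · exact ⟨fun i => (abs_le.mp (h2 i)).1, fun i => (abs_le.mp (h2 i)).2⟩
  refine ne_top_of_le_ne_top ?_ (measure_mono hsub)
  unfold muX
  rw [Measure.prod_prod]
  refine ENNReal.mul_ne_top ?_ (isCompact_Icc).measure_lt_top.ne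
  exact (Measure.count_apply_lt_top.mpr (Set.Finite.pi fun i => Set.finite_Icc _ _)).ne

lemma integrable_of_l2 (lam N : ℝ) (hl : 1 ≤ lam) {m n : ℕ} (G : XX m n → ℂ) (hG : Measurable G)
    (hs : ∀ k, k ∉ regA lam N m n → G k = 0) (h2 : ∫⁻ k, ‖G k‖ₑ ^ 2 ∂(muX m n) ≠ ⊤) :
    Integrable G (muX m n) := by
  refine ⟨hG.aestronglyMeasurable, ?_⟩
  have hle : ∀ k, ‖G k‖ₑ ≤ (regA lam N m n).indicator (fun _ => (1 : ℝ≥0∞)) k + ‖G k‖ₑ ^ 2 := by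
    intro k
    by_cases hk : k ∈ regA lam N m n
    · rw [Set.indicator_of_mem hk]
      simpa using ennreal_mul_le_sq_add 1 ‖G k‖ₑ
    · simp [hs k hk]
  unfold HasFiniteIntegral
  refine (lintegral_mono hle).trans_lt ?_
  rw [lintegral_add_right _ (by fun_prop), lintegral_indicator_const (regA_meas lam N m n), one_mul]
  exact ENNReal.add_lt_top.mpr ⟨(regA_fin lam N hl m n).lt_top, h2.lt_top⟩

lemma lint_nuP (δ ε lam : ℝ) (hδ : 0 < δ) (hε : 0 < ε) (m n : ℕ) (f : ℝ × ((Fin m → ℝ) × (Fin n → ℝ)) → ℝ≥0∞)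
    (hf : Measurable f) :
    ∫⁻ p, f p ∂(nuP δ ε lam m n) = ∫⁻ t : ℝ, ENNReal.ofReal (Real.exp (-δ * t ^ 2)) *
      ∫⁻ x : Fin m → ℝ, ENNReal.ofReal (gD ε x) * ∫⁻ y in torusBox lam n, f (t, x, y) := by
  have := nuT_fin δ hδ
  have := nuX_fin ε hε m
  have := torusBox_fin lam n
  unfold nuP
  rw [lintegral_prod _ (by fun_prop)]
  unfold nuT
  rw [lintegral_withDensity_eq_lintegral_mul _ (by fun_prop) (Measurable.lintegral_prod_right' (f := fun q : ℝ × ((Fin m → ℝ) × (Fin n → ℝ)) => f (q.1, q.2)) (by fun_prop))]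
  congr 1; ext t
  simp only [Pi.mul_apply]
  congr 1
  rw [lintegral_prod _ (by fun_prop)]
  unfold nuX
  rw [lintegral_withDensity_eq_lintegral_mul _ (gD_measurable ε m).ennreal_ofReal (Measurable.lintegral_prod_right' (f := fun q : ((Fin m → ℝ) × (Fin n → ℝ)) => f (t, q.1, q.2)) (by fun_prop))]
  rfl

/-- hypothesis: level set bound -/
def LevelBound (lam N₁ N₂ η B : ℝ) (m n : ℕ) : Prop :=
  ∀ (K : XX m n) (a : ℝ), muX m n (levelS lam N₁ N₂ K ∩
      {k | a ≤ phi lam (K - k) + phi lam k ∧ phi lam (K - k) + phi lam k < a + η}) ≤ ENNReal.ofReal (lam ^ n * B * η)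

def FF (lam : ℝ) {m n : ℕ} (g₁ g₂ : (Fin m → ℝ) → (Fin n → ℤ) → ℂ) (t : ℝ) (x : Fin m → ℝ) : ℝ≥0∞ :=
  ∫⁻ y in torusBox lam n, (‖waveU lam g₁ t x y * waveU lam g₂ t x y‖₊ : ℝ≥0∞) ^ 2

/-- data for which everything is nice -/
lemma FF_nice (lam N₁ N₂ : ℝ) (hl : 1 ≤ lam) {m n : ℕ} 
    (G₁ G₂ : XX m n → ℂ) (h₁ : Measurable G₁) (h₂ : Measurable G₂) (hi₁ : Integrable G₁ (muX m n))
    (hi₂ : Integrable G₂ (muX m n)) (hs₁ : ∀ k, k ∉ regA lam N₁ m n → G₁ k = 0) (hs₂ : ∀ k, k ∉ regA lam N₂ m n → G₂ k = 0) :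
    (Measurable (fun q : ℝ × (Fin m → ℝ) => FF lam (fun ζ j => G₁ (j, ζ)) (fun ζ j => G₂ (j, ζ)) q.1 q.2)) ∧
    ∀ η ε B : ℝ, 0 < η → 0 < ε → 0 ≤ B → LevelBound lam N₁ N₂ η B m n →
      ∫⁻ t : ℝ, ENNReal.ofReal (Real.exp (-(η ^ 2 / 4) * t ^ 2)) *
        ∫⁻ x : Fin m → ℝ, ENNReal.ofReal (gD ε x) * FF lam (fun ζ j => G₁ (j, ζ)) (fun ζ j => G₂ (j, ζ)) t x ≤
      ENNReal.ofReal (Kc m n * B) * l2sq lam (fun ζ j => G₁ (j, ζ)) * l2sq lam (fun ζ j => G₂ (j, ζ)) := by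
  have := torusBox_fin lam n
  have hU : ∀ G : XX m n → ℂ, Measurable G → Measurable (fun p : ℝ × ((Fin m → ℝ) × (Fin n → ℝ)) => 
      ∫ k, G k * Complex.exp (Complex.I * (th lam p k : ℂ)) ∂(muX m n)) := by
    intro G hG
    apply StronglyMeasurable.measurable
    refine StronglyMeasurable.integral_prod_right (f := fun p k => G k * Complex.exp (Complex.I * (th lam p k : ℂ))) ?_
    apply Measurable.stronglyMeasurable
    have := th_meas lam m n
    unfold Function.uncurry
    fun_prop
  set c : ℂ := ((1 / lam ^ n : ℝ) : ℂ) with hc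
  set f : ℝ × ((Fin m → ℝ) × (Fin n → ℝ)) → ℝ≥0∞ := fun p => 
    ‖(∫ k, G₁ k * Complex.exp (Complex.I * (th lam p k : ℂ)) ∂(muX m n)) * 
      (∫ k, G₂ k * Complex.exp (Complex.I * (th lam p k : ℂ)) ∂(muX m n))‖ₑ ^ 2 with hf
  have hfm : Measurable f := by
    have a1 := hU G₁ h₁
    have a2 := hU G₂ h₂
    fun_prop
  have e1 : ∀ t x, FF lam (fun ζ j => G₁ (j, ζ)) (fun ζ j => G₂ (j, ζ)) t x = 
      ‖c‖ₑ ^ 4 * ∫⁻ y in torusBox lam n, f (t, x, y) := by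
    intro t x
    rw [← lintegral_const_mul _ (by fun_prop)]
    unfold FF
    congr 1; ext y
    have w1 := waveU_eq lam G₁ hi₁ (t, x, y)
    have w2 := waveU_eq lam G₂ hi₂ (t, x, y)
    simp only at w1 w2
    rw [w1, w2, ← enorm_eq_nnnorm]
    simp only [hf, enorm_mul, ← hc]
    ring
  refine ⟨?_, ?_⟩
  · simp_rw [e1]
    refine Measurable.const_mul ?_ _
    exact Measurable.lintegral_prod_right' (f := fun q : (ℝ × (Fin m → ℝ)) × (Fin n → ℝ) => f (q.1.1, q.1.2, q.2)) (by fun_prop)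
  · intro η ε B hη hε hB0 hB
    simp_rw [e1]
    have hcb := core_bound lam N₁ N₂ η ε B hl hη hε hB0 hB G₁ G₂ h₁ h₂ hi₁ hi₂ hs₁ hs₂
    rw [lint_nuP _ _ _ (by positivity) hε _ _ _ hfm] at hcb
    have hgm := gD_measurable ε m
    have e2 : ∀ t : ℝ, ENNReal.ofReal (Real.exp (-(η ^ 2 / 4) * t ^ 2)) *
        ∫⁻ x : Fin m → ℝ, ENNReal.ofReal (gD ε x) * (‖c‖ₑ ^ 4 * ∫⁻ y in torusBox lam n, f (t, x, y)) =
        ‖c‖ₑ ^ 4 * (ENNReal.ofReal (Real.exp (-(η ^ 2 / 4) * t ^ 2)) *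
        ∫⁻ x : Fin m → ℝ, ENNReal.ofReal (gD ε x) * (∫⁻ y in torusBox lam n, f (t, x, y))) := by
      intro t
      have hm0 : Measurable (fun x => ENNReal.ofReal (gD ε x) * (∫⁻ y in torusBox lam n, f (t, x, y))) := by
        refine hgm.ennreal_ofReal.mul ?_
        exact Measurable.lintegral_prod_right' (f := fun q : ((Fin m → ℝ)) × (Fin n → ℝ) => f (t, q.1, q.2)) (by fun_prop)
      have e3 : ∫⁻ x : Fin m → ℝ, ENNReal.ofReal (gD ε x) * (‖c‖ₑ ^ 4 * ∫⁻ y in torusBox lam n, f (t, x, y)) =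
          ‖c‖ₑ ^ 4 * ∫⁻ x : Fin m → ℝ, ENNReal.ofReal (gD ε x) * (∫⁻ y in torusBox lam n, f (t, x, y)) := by
        rw [← lintegral_const_mul _ hm0]
        exact lintegral_congr fun x => mul_left_comm _ _ _
      rw [e3, mul_left_comm]
    simp_rw [e2]
    rw [lintegral_const_mul' _ _ (by finiteness)]
    calc _ ≤ ‖c‖ₑ ^ 4 * (ENNReal.ofReal (Kc m n * B * lam ^ n * lam ^ n) * (∫⁻ k, ‖G₁ k‖ₑ ^ 2 ∂(muX m n)) * (∫⁻ k, ‖G₂ k‖ₑ ^ 2 ∂(muX m n))) := mul_le_mul_right hcb _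
      _ = _ := by
        rw [l2sq_eq lam G₁ h₁, l2sq_eq lam G₂ h₂]
        have hcn : ‖c‖ₑ = ENNReal.ofReal (1 / lam ^ n) := by
          rw [← ofReal_norm, hc, Complex.norm_real, Real.norm_of_nonneg (by positivity)]
        have : ENNReal.ofReal (Kc m n * B * lam ^ n * lam ^ n) = ENNReal.ofReal (Kc m n * B) * ENNReal.ofReal (lam ^ n) ^ 2 := by
          have := Kc_nonneg m n
          rw [sq, ← ENNReal.ofReal_mul (by positivity), ← ENNReal.ofReal_mul (by positivity)]
          congr 1; ring
        rw [hcn, this]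
        have hone : ENNReal.ofReal (1 / lam ^ n) * ENNReal.ofReal (lam ^ n) = 1 := by
          rw [← ENNReal.ofReal_mul (by positivity), one_div, inv_mul_cancel₀ (by positivity), ENNReal.ofReal_one]
        set a := ENNReal.ofReal (1 / lam ^ n)
        set b := ENNReal.ofReal (lam ^ n)
        calc _ = (a * b) ^ 2 * (ENNReal.ofReal (Kc m n * B) * (a * ∫⁻ k, ‖G₁ k‖ₑ ^ 2 ∂(muX m n)) * (a * ∫⁻ k, ‖G₂ k‖ₑ ^ 2 ∂(muX m n))) := by ring
          _ = _ := by rw [hone]; simp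

lemma tendsto_seq : Filter.Tendsto (fun k : ℕ => 1 / ((k : ℝ) + 1)) Filter.atTop (nhds 0) :=
  tendsto_one_div_add_atTop_nhds_zero_nat

/-- remove the spatial weight -/
lemma FF_nice2 {m : ℕ} (F : ℝ → (Fin m → ℝ) → ℝ≥0∞) (hF : Measurable (fun q : ℝ × (Fin m → ℝ) => F q.1 q.2))
    (w : ℝ → ℝ≥0∞) (hw : Measurable w) (A : ℝ≥0∞)
    (h : ∀ ε : ℝ, 0 < ε → ∫⁻ t : ℝ, w t * ∫⁻ x : Fin m → ℝ, ENNReal.ofReal (gD ε x) * F t x ≤ A) :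
    ∫⁻ t : ℝ, w t * ∫⁻ x : Fin m → ℝ, F t x ≤ A := by
  have hgm := fun ε => gD_measurable ε m
  set ε : ℕ → ℝ := fun k => 1 / ((k : ℝ) + 1)
  have hε : ∀ k, 0 < ε k := fun k => by simp only [ε]; positivity
  have hlim : ∀ x : Fin m → ℝ, Filter.Tendsto (fun k => ENNReal.ofReal (gD (ε k) x)) Filter.atTop (nhds 1) := by
    intro x
    have : Filter.Tendsto (fun k => gD (ε k) x) Filter.atTop (nhds (Real.exp (-0 * ∑ i, x i ^ 2))) := by
      unfold gD
      exact (Real.continuous_exp.tendsto _).comp ((tendsto_seq.neg).mul_const _)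
    rw [neg_zero, zero_mul, Real.exp_zero] at this
    simpa using ENNReal.tendsto_ofReal this
  have hmeas : ∀ k t, Measurable (fun x => w t * (ENNReal.ofReal (gD (ε k) x) * F t x)) := by
    intro k t
    have : Measurable (F t) := hF.comp (measurable_prodMk_left (x := t))
    have := hgm (ε k)
    fun_prop
  have hmeas2 : ∀ k, Measurable (fun t => ∫⁻ x, w t * (ENNReal.ofReal (gD (ε k) x) * F t x)) := by
    intro k
    have := hgm (ε k)
    refine Measurable.lintegral_prod_right' (f := fun q : ℝ × (Fin m → ℝ) => w q.1 * (ENNReal.ofReal (gD (ε k) q.2) * F q.1 q.2)) ?_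
    fun_prop
  have hmF : ∀ t, Measurable (F t) := fun t => hF.comp (measurable_prodMk_left (x := t))
  calc ∫⁻ t : ℝ, w t * ∫⁻ x : Fin m → ℝ, F t x = 
      ∫⁻ t : ℝ, ∫⁻ x : Fin m → ℝ, Filter.liminf (fun k => w t * (ENNReal.ofReal (gD (ε k) x) * F t x)) Filter.atTop := by
        congr 1; ext t
        rw [← lintegral_const_mul _ (hmF t)]
        congr 1; ext x
        refine (Filter.Tendsto.liminf_eq ?_).symm
        have h2 : ∀ k, w t * (ENNReal.ofReal (gD (ε k) x) * F t x) = ENNReal.ofReal (gD (ε k) x) * (w t * F t x) := fun k => by ring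
        simp_rw [h2]
        simpa using ENNReal.Tendsto.mul_const (b := w t * F t x) (hlim x) (Or.inl one_ne_zero)
    _ ≤ ∫⁻ t : ℝ, Filter.liminf (fun k => ∫⁻ x : Fin m → ℝ, w t * (ENNReal.ofReal (gD (ε k) x) * F t x)) Filter.atTop := by
        gcongr with t
        exact lintegral_liminf_le (fun k => hmeas k t)
    _ ≤ Filter.liminf (fun k => ∫⁻ t : ℝ, ∫⁻ x : Fin m → ℝ, w t * (ENNReal.ofReal (gD (ε k) x) * F t x)) Filter.atTop := 
        lintegral_liminf_le hmeas2
    _ ≤ A := by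
        refine Filter.liminf_le_of_le (by isBoundedDefault) ?_
        intro b hb
        obtain ⟨k, hk⟩ := hb.exists
        refine hk.trans (le_trans (le_of_eq ?_) (h (ε k) (hε k)))
        congr 1; ext t
        have := hgm (ε k)
        have := hmF t
        rw [lintegral_const_mul _ (by fun_prop)]

/-- fixed time scale -/
lemma time_weighted (lam N₁ N₂ η B : ℝ) (hl : 1 ≤ lam) (hη : 0 < η) (hB0 : 0 < B) {m n : ℕ}
    (g₁ g₂ : (Fin m → ℝ) → (Fin n → ℤ) → ℂ) (hs₁ : SuppIn lam g₁ N₁) (hs₂ : SuppIn lam g₂ N₂)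
    (hB : LevelBound lam N₁ N₂ η B m n) :
    ∫⁻ t : ℝ, ENNReal.ofReal (Real.exp (-(η ^ 2 / 4) * t ^ 2)) * ∫⁻ x : Fin m → ℝ, FF lam g₁ g₂ t x ≤
      ENNReal.ofReal ((Kc m n + 1) * B) * l2sq lam g₁ * l2sq lam g₂ := by
  obtain ⟨G₁, h₁, hG₁, hw₁, hn₁⟩ := reduce lam N₁ g₁ hs₁
  obtain ⟨G₂, h₂, hG₂, hw₂, hn₂⟩ := reduce lam N₂ g₂ hs₂
  have hFF : ∀ t x, FF lam g₁ g₂ t x = FF lam (fun ζ j => G₁ (j, ζ)) (fun ζ j => G₂ (j, ζ)) t x := by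
    intro t x
    unfold FF
    simp_rw [hw₁, hw₂]
  have hK := Kc_nonneg m n
  refine le_trans ?_ (mul_le_mul' (mul_le_mul' le_rfl hn₁) hn₂)
  simp_rw [hFF]
  have hpos : ENNReal.ofReal ((Kc m n + 1) * B) ≠ 0 := by
    simp; positivity
  by_cases z₁ : l2sq lam (fun ζ j => G₁ (j, ζ)) = 0
  · simp [FF, waveU_zero_of_l2sq lam hl G₁ h₁ z₁]
  by_cases z₂ : l2sq lam (fun ζ j => G₂ (j, ζ)) = 0
  · simp [FF, waveU_zero_of_l2sq lam hl G₂ h₂ z₂]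
  by_cases i₁ : l2sq lam (fun ζ j => G₁ (j, ζ)) = ⊤
  · rw [i₁, ENNReal.mul_top hpos, ENNReal.top_mul z₂]; exact le_top
  by_cases i₂ : l2sq lam (fun ζ j => G₂ (j, ζ)) = ⊤
  · rw [i₂, ENNReal.mul_top (mul_ne_zero hpos z₁)]; exact le_top
  have hfin : ∀ G : XX m n → ℂ, Measurable G → l2sq lam (fun ζ j => G (j, ζ)) ≠ ⊤ → ∫⁻ k, ‖G k‖ₑ ^ 2 ∂(muX m n) ≠ ⊤ := by
    intro G hG h h'
    rw [l2sq_eq lam G hG, h', ENNReal.mul_top (by simp; positivity)] at h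
    exact h rfl
  obtain ⟨hm, hb⟩ := FF_nice lam N₁ N₂ hl G₁ G₂ h₁ h₂ (integrable_of_l2 lam N₁ hl G₁ h₁ hG₁ (hfin G₁ h₁ i₁))
    (integrable_of_l2 lam N₂ hl G₂ h₂ hG₂ (hfin G₂ h₂ i₂)) hG₁ hG₂
  refine FF_nice2 _ hm _ (by fun_prop) _ ?_
  intro ε hε
  refine (hb η ε B hη hε hB0.le hB).trans ?_
  gcongr
  linarith

lemma time_box (lam N₁ N₂ T B : ℝ) (hl : 1 ≤ lam) (hT : 0 < T) (hB0 : 0 < B) {m n : ℕ}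
    (g₁ g₂ : (Fin m → ℝ) → (Fin n → ℤ) → ℂ) (hs₁ : SuppIn lam g₁ N₁) (hs₂ : SuppIn lam g₂ N₂)
    (hB : LevelBound lam N₁ N₂ (1 / T) B m n) :
    ∫⁻ t in Set.Icc (-T) T, ∫⁻ x : Fin m → ℝ, FF lam g₁ g₂ t x ≤
      ENNReal.ofReal (2 * (Kc m n + 1) * B) * l2sq lam g₁ * l2sq lam g₂ := by
  have h := time_weighted lam N₁ N₂ (1 / T) B hl (by positivity) hB0 g₁ g₂ hs₁ hs₂ hB
  have hK := Kc_nonneg m n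
  have e : ENNReal.ofReal (2 * (Kc m n + 1) * B) * l2sq lam g₁ * l2sq lam g₂ =
      2 * (ENNReal.ofReal ((Kc m n + 1) * B) * l2sq lam g₁ * l2sq lam g₂) := by
    rw [mul_assoc 2, ENNReal.ofReal_mul (by norm_num)]
    simp [mul_assoc]
  rw [e]
  refine le_trans ?_ (mul_le_mul_right h 2)
  rw [← lintegral_const_mul' _ _ (by finiteness)]
  refine le_trans (setLIntegral_mono' measurableSet_Icc (g := fun t => 2 * (ENNReal.ofReal (Real.exp (-((1 / T) ^ 2 / 4) * t ^ 2)) * ∫⁻ x : Fin m → ℝ, FF lam g₁ g₂ t x)) ?_) (setLIntegral_le_lintegral _ _)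
  intro t ht
  rw [← mul_assoc]
  refine le_mul_of_one_le_left (by simp) ?_
  have h1 : (1 / T) ^ 2 * t ^ 2 ≤ 1 := by
    rw [← mul_pow, ← sq_abs]
    refine pow_le_one₀ (abs_nonneg _) ?_
    rw [abs_mul, abs_of_pos (by positivity : 0 < 1 / T), one_div, inv_mul_le_iff₀ hT, mul_one]
    exact abs_le.mpr ht
  have h2 := Real.add_one_le_exp (-((1 / T) ^ 2 / 4) * t ^ 2)
  calc (1 : ℝ≥0∞) = ENNReal.ofReal (2 * (1 / 2)) := by norm_num
    _ ≤ ENNReal.ofReal (2 * Real.exp (-((1 / T) ^ 2 / 4) * t ^ 2)) := by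
        refine ENNReal.ofReal_le_ofReal ?_
        linarith
    _ = _ := by rw [ENNReal.ofReal_mul (by norm_num)]; simp

lemma time_global (lam N₁ N₂ B : ℝ) (hl : 1 ≤ lam) (hB0 : 0 < B) {m n : ℕ}
    (g₁ g₂ : (Fin m → ℝ) → (Fin n → ℤ) → ℂ) (hs₁ : SuppIn lam g₁ N₁) (hs₂ : SuppIn lam g₂ N₂)
    (hB : ∀ η : ℝ, 0 < η → η ≤ 1 → LevelBound lam N₁ N₂ η B m n) :
    ∫⁻ t : ℝ, ∫⁻ x : Fin m → ℝ, FF lam g₁ g₂ t x ≤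
      ENNReal.ofReal (2 * (Kc m n + 1) * B) * l2sq lam g₁ * l2sq lam g₂ := by
  have hU : (⋃ k : ℕ, Set.Icc (-((k : ℝ) + 1)) ((k : ℝ) + 1)) = Set.univ := by
    refine Set.eq_univ_of_forall fun t => ?_
    obtain ⟨k, hk⟩ := exists_nat_ge |t|
    exact Set.mem_iUnion.mpr ⟨k, abs_le.mp (by linarith)⟩
  rw [← setLIntegral_univ, ← hU, setLIntegral_iUnion_of_directed]
  · refine iSup_le fun k => ?_
    refine time_box lam N₁ N₂ ((k : ℝ) + 1) B hl (by positivity) hB0 g₁ g₂ hs₁ hs₂ (hB _ (by positivity) ?_)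
    rw [div_le_one (by positivity)]
    have : (0 : ℝ) ≤ k := by positivity
    linarith
  · refine Monotone.directed_le ?_
    intro a b hab
    have : (a : ℝ) ≤ b := by exact_mod_cast hab
    exact Set.Icc_subset_Icc (by linarith) (by linarith)

lemma rpow_final (I L₁ L₂ : ℝ≥0∞) (A D : ℝ) (hA : 0 ≤ A)  (h : I ≤ ENNReal.ofReal (A * D) * L₁ * L₂) :
    I ^ (1 / 2 : ℝ) ≤ ENNReal.ofReal (Real.sqrt A * Real.sqrt D) * L₁ ^ (1 / 2 : ℝ) * L₂ ^ (1 / 2 : ℝ) := by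
  refine (ENNReal.rpow_le_rpow h (by norm_num)).trans (le_of_eq ?_)
  rw [ENNReal.mul_rpow_of_nonneg _ _ (by norm_num), ENNReal.mul_rpow_of_nonneg _ _ (by norm_num)]
  congr 2
  rw [← Real.sqrt_mul hA, Real.sqrt_eq_rpow]
  rcases le_or_gt 0 (A * D) with h | h
  · rw [ENNReal.ofReal_rpow_of_nonneg h (by norm_num)]
  · rw [ENNReal.ofReal_of_nonpos h.le, ← Real.sqrt_eq_rpow, Real.sqrt_eq_zero_of_nonpos h.le]
    simp


/-- annular piece -/
def annS (R b η : ℝ) {m : ℕ} (c : Fin m → ℝ) : Set (Fin m → ℝ) :=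
  {z | (∀ i, |z i| ≤ R) ∧ b ≤ ∑ i, (z i - c i) ^ 2 ∧ ∑ i, (z i - c i) ^ 2 < b + η}

lemma annS_meas (R b η : ℝ) {m : ℕ} (c : Fin m → ℝ) : MeasurableSet (annS R b η c) := by
  have h : Measurable (fun z : Fin m → ℝ => ∑ i, (z i - c i) ^ 2) := by fun_prop
  have e : annS R b η c = {z | ∀ i, |z i| ≤ R} ∩ ({z | b ≤ ∑ i, (z i - c i) ^ 2} ∩ {z | ∑ i, (z i - c i) ^ 2 < b + η}) := rfl
  rw [e]
  refine MeasurableSet.inter ?_ (MeasurableSet.inter ?_ ?_)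
  · rw [Set.ofPred_forall]
    refine MeasurableSet.iInter fun i => ?_
    exact measurableSet_le (by fun_prop) measurable_const
  · exact measurableSet_le measurable_const h
  · exact measurableSet_lt h measurable_const

lemma annS_insert (R b η : ℝ) {m : ℕ} (c : Fin (m + 1) → ℝ) (i : Fin (m + 1)) (x : ℝ) (z : Fin m → ℝ) :
    i.insertNth (α := fun _ => ℝ) x z ∈ annS R b η c ↔ |x| ≤ R ∧ (∀ k, |z k| ≤ R) ∧ 
      b ≤ (x - c i) ^ 2 + ∑ k, (z k - c (i.succAbove k)) ^ 2 ∧ 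
      (x - c i) ^ 2 + ∑ k, (z k - c (i.succAbove k)) ^ 2 < b + η := by
  unfold annS
  simp only [Set.mem_ofPred_eq]
  rw [Fin.sum_univ_succAbove _ i, i.forall_iff_succAbove]
  simp [and_assoc]

lemma annS_prod (R b η : ℝ) {m : ℕ} (c : Fin (m + 1) → ℝ) (i : Fin (m + 1)) :
    volume (annS R b η c) = (volume.prod volume) {p : ℝ × (Fin m → ℝ) | i.insertNth (α := fun _ => ℝ) p.1 p.2 ∈ annS R b η c} := by
  have h := (volume_preserving_piFinSuccAbove (fun _ : Fin (m + 1) => ℝ) i).symm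
  rw [← h.measure_preimage (annS_meas R b η c).nullMeasurableSet]
  rfl

lemma annS_prod_meas (R b η : ℝ) {m : ℕ} (c : Fin (m + 1) → ℝ) (i : Fin (m + 1)) :
    MeasurableSet {p : ℝ × (Fin m → ℝ) | i.insertNth (α := fun _ => ℝ) p.1 p.2 ∈ annS R b η c} := by
  have h := (MeasurableEquiv.piFinSuccAbove (fun _ : Fin (m + 1) => ℝ) i).symm.measurable
  exact h (annS_meas R b η c)

lemma vol_one (R b η c : ℝ) (hη : 0 < η) (hc : 2 * R ≤ |c|) (hc0 : 0 < |c|) :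
    volume {x : ℝ | |x| ≤ R ∧ b ≤ (x - c) ^ 2 ∧ (x - c) ^ 2 < b + η} ≤ ENNReal.ofReal (η / |c|) := by
  refine (Real.volume_le_diam _).trans ?_
  refine Metric.ediam_le fun x hx y hy => ?_
  rw [edist_dist, Real.dist_eq]
  refine ENNReal.ofReal_le_ofReal ?_
  rw [le_div_iff₀ hc0]
  have h1 : |c| ≤ |x + y - 2 * c| := by
    have h2 : |2 * c| ≤ |x + y - 2 * c| + |x + y| := by
      have := abs_sub_abs_le_abs_sub (2 * c) (x + y)
      rw [abs_sub_comm (2 * c) (x + y)] at this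
      linarith
    rw [abs_mul, abs_two] at h2
    have := abs_add_le x y
    linarith [hx.1, hy.1]
  calc |x - y| * |c| ≤ |x - y| * |x + y - 2 * c| := by gcongr
    _ = |(x - c) ^ 2 - (y - c) ^ 2| := by rw [← abs_mul]; congr 1; ring
    _ ≤ η := by
      rw [abs_le]
      constructor <;> linarith [hx.2.1, hx.2.2, hy.2.1, hy.2.2]

lemma box_vol (R : ℝ) (hR : 0 ≤ R) (m : ℕ) : volume {z : Fin m → ℝ | ∀ k, |z k| ≤ R} = ENNReal.ofReal ((2 * R) ^ m) := by
  have : {z : Fin m → ℝ | ∀ k, |z k| ≤ R} = Set.univ.pi fun _ => Set.Icc (-R) R := by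
    ext z; simp [abs_le, forall_and, Pi.le_def]
  rw [this, volume_pi_pi]
  simp only [Real.volume_Icc, Finset.prod_const, Finset.card_univ, Fintype.card_fin]
  rw [ENNReal.ofReal_pow (by linarith)]
  congr 2; ring

lemma vol_far (R b η : ℝ) (hR : 0 < R) (hη : 0 < η) {m : ℕ} (c : Fin (m + 1) → ℝ) (i : Fin (m + 1))
    (hc : 2 * R ≤ |c i|) : volume (annS R b η c) ≤ ENNReal.ofReal ((2 * R) ^ m * (η / |c i|)) := by
  have hc0 : 0 < |c i| := by linarith
  rw [annS_prod R b η c i, Measure.prod_apply_symm (annS_prod_meas R b η c i)]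
  rw [ENNReal.ofReal_mul (by positivity), ← box_vol R hR.le, mul_comm]
  have hmb : MeasurableSet {z : Fin m → ℝ | ∀ k, |z k| ≤ R} := by
    rw [Set.ofPred_forall]
    exact MeasurableSet.iInter fun i => measurableSet_le (by fun_prop) measurable_const
  rw [← lintegral_indicator_const hmb]
  refine lintegral_mono fun z => ?_
  by_cases hz : ∀ k, |z k| ≤ R
  · rw [Set.indicator_of_mem (by exact hz)]
    refine le_trans (measure_mono ?_) (vol_one R (b - ∑ k, (z k - c (i.succAbove k)) ^ 2) η (c i) hη hc hc0)
    intro x hx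
    have := (annS_insert R b η c i x z).mp hx
    exact ⟨this.1, by linarith [this.2.2.1], by linarith [this.2.2.2]⟩
  · rw [Set.indicator_of_notMem (by exact hz)]
    refine le_of_eq (measure_mono_null (t := ∅) ?_ measure_empty)
    intro x hx
    exact hz ((annS_insert R b η c i x z).mp hx).2.1

lemma disc_vol (r : ℝ) (c : Fin 2 → ℝ) : 
    volume {z : Fin 2 → ℝ | ∑ i, (z i - c i) ^ 2 < r} = ENNReal.ofReal (Real.pi * r) := by
  have hm : MeasurableSet {z : Fin 2 → ℝ | ∑ i, (z i - c i) ^ 2 < r} :=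
    measurableSet_lt (by fun_prop) measurable_const
  rw [← Complex.volume_preserving_equiv_pi.measure_preimage hm.nullMeasurableSet]
  rcases le_or_gt r 0 with hr | hr
  · rw [ENNReal.ofReal_of_nonpos (by nlinarith [Real.pi_pos])]
    refine measure_mono_null (t := ∅) ?_ measure_empty
    intro z hz
    have h1 : 0 ≤ ∑ i, ((Complex.measurableEquivPi z) i - c i) ^ 2 := Finset.sum_nonneg fun i _ => sq_nonneg _
    have h2 : ∑ i, ((Complex.measurableEquivPi z) i - c i) ^ 2 < r := hz
    linarith
  · have : (Complex.measurableEquivPi ⁻¹' {z : Fin 2 → ℝ | ∑ i, (z i - c i) ^ 2 < r}) = Metric.ball (⟨c 0, c 1⟩ : ℂ) (Real.sqrt r) := by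
      ext z
      simp only [Set.mem_preimage, Set.mem_ofPred_eq, Metric.mem_ball, Fin.sum_univ_two]
      rw [Complex.dist_eq, Complex.norm_def, Real.sqrt_lt_sqrt_iff (Complex.normSq_nonneg _), Complex.normSq_apply]
      simp [Complex.measurableEquivPi_apply, sq]
    rw [this, Complex.volume_ball, ENNReal.ofReal_mul Real.pi_pos.le, ← ENNReal.ofReal_pow (Real.sqrt_nonneg _),
      Real.sq_sqrt hr.le, mul_comm]
    congr 1
    rw [← NNReal.coe_real_pi, ENNReal.ofReal_coe_nnreal]

lemma vol_ann (R η : ℝ) (hR : 0 < R) (hη : 0 < η) (m : ℕ) : ∀ (b : ℝ) (c : Fin (m + 2) → ℝ), 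
    volume (annS R b η c) ≤ ENNReal.ofReal ((2 * R) ^ m * (Real.pi * η)) := by
  induction m with
  | zero =>
    intro b c
    have h1 : annS R b η c ⊆ {z : Fin 2 → ℝ | ∑ i, (z i - c i) ^ 2 < b + η} \ {z : Fin 2 → ℝ | ∑ i, (z i - c i) ^ 2 < b} := by
      intro z hz
      exact ⟨hz.2.2, not_lt.mpr hz.2.1⟩
    refine (measure_mono h1).trans ?_
    have hm : MeasurableSet {z : Fin 2 → ℝ | ∑ i, (z i - c i) ^ 2 < b} :=
      measurableSet_lt (by fun_prop) measurable_const
    have hsub : {z : Fin 2 → ℝ | ∑ i, (z i - c i) ^ 2 < b} ⊆ {z : Fin 2 → ℝ | ∑ i, (z i - c i) ^ 2 < b + η} := by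
      intro z hz
      simp only [Set.mem_ofPred_eq] at hz ⊢
      linarith
    rw [measure_sdiff hsub hm.nullMeasurableSet (by rw [disc_vol]; finiteness), disc_vol, disc_vol]
    rw [tsub_le_iff_right]
    calc ENNReal.ofReal (Real.pi * (b + η)) = ENNReal.ofReal ((2 * R) ^ 0 * (Real.pi * η) + Real.pi * b) := by congr 1; ring
      _ ≤ _ := ENNReal.ofReal_add_le
  | succ m ih =>
    intro b c
    rw [annS_prod R b η c 0, Measure.prod_apply (annS_prod_meas R b η c 0)]
    have hmb : MeasurableSet (Set.Icc (-R) R) := measurableSet_Icc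
    have e : ENNReal.ofReal ((2 * R) ^ (m + 1) * (Real.pi * η)) = ENNReal.ofReal ((2 * R) ^ m * (Real.pi * η)) * volume (Set.Icc (-R) R) := by
      rw [Real.volume_Icc, ← ENNReal.ofReal_mul (by positivity)]
      congr 1; ring
    rw [e, ← lintegral_indicator_const hmb]
    refine lintegral_mono fun x => ?_
    by_cases hx : x ∈ Set.Icc (-R) R
    · rw [Set.indicator_of_mem hx]
      refine le_trans (measure_mono ?_) (ih (b - (x - c 0) ^ 2) (fun k => c (Fin.succAbove 0 k)))
      intro z hz
      have := (annS_insert R b η c 0 x z).mp hz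
      exact ⟨this.2.1, by linarith [this.2.2.1], by linarith [this.2.2.2]⟩
    · rw [Set.indicator_of_notMem hx]
      refine le_of_eq (measure_mono_null (t := ∅) ?_ measure_empty)
      intro z hz
      exact hx (abs_le.mp ((annS_insert R b η c 0 x z).mp hz).1)


def LSet (lam N₁ N₂ η : ℝ) {m n : ℕ} (K : XX m n) (a : ℝ) : Set (XX m n) :=
  levelS lam N₁ N₂ K ∩ {k | a ≤ phi lam (K - k) + phi lam k ∧ phi lam (K - k) + phi lam k < a + η}

lemma LSet_meas (lam N₁ N₂ η : ℝ) {m n : ℕ} (K : XX m n) (a : ℝ) : MeasurableSet (LSet lam N₁ N₂ η K a) := by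
  have h2 : Measurable (fun k : XX m n => K - k) := by fun_prop
  have h1 : Measurable (fun k : XX m n => phi lam (K - k) + phi lam k) := 
    ((phi_meas lam m n).comp h2).add (phi_meas lam m n)
  refine (levelS_meas lam N₁ N₂ K).inter ?_
  exact (measurableSet_le measurable_const h1).inter (measurableSet_lt h1 measurable_const)

def bx (lam N : ℝ) (n : ℕ) : Finset (Fin n → ℤ) := 
  Fintype.piFinset fun _ : Fin n => Finset.Icc ⌈-(lam * (2 * N))⌉ ⌊lam * (2 * N)⌋

lemma mem_bx (lam N : ℝ) (n : ℕ) (j : Fin n → ℤ) : j ∈ bx lam N n ↔ ∀ i, |(j i : ℝ)| ≤ lam * (2 * N) := by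
  unfold bx
  rw [Fintype.mem_piFinset]
  refine forall_congr' fun i => ?_
  rw [Finset.mem_Icc, abs_le, Int.ceil_le, Int.le_floor]

lemma bx_card (lam N : ℝ) (hl : 1 ≤ lam) (hN : 1 ≤ N) (n : ℕ) : ((bx lam N n).card : ℝ) ≤ (5 * lam * N) ^ n := by
  unfold bx
  rw [Fintype.card_piFinset]
  simp only [Finset.prod_const, Finset.card_univ, Fintype.card_fin, Int.card_Icc]
  push_cast
  gcongr
  have h1 : (1 : ℝ) ≤ lam * N := by nlinarith
  have h2 : ((⌊lam * (2 * N)⌋ + 1 - ⌈-(lam * (2 * N))⌉ : ℤ) : ℝ) ≤ 5 * lam * N := by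
    push_cast
    have := Int.floor_le (lam * (2 * N))
    have := Int.le_ceil (-(lam * (2 * N)))
    nlinarith
  have h3 : (0 : ℝ) ≤ 5 * lam * N := by positivity
  have h4 : (((⌊lam * (2 * N)⌋ + 1 - ⌈-(lam * (2 * N))⌉).toNat : ℤ) : ℝ) ≤ 5 * lam * N := by
    rw [Int.toNat_eq_max]
    push_cast at h2 ⊢
    exact max_le h2 h3
  exact_mod_cast h4

def JJ (lam N₁ N₂ η : ℝ) {m n : ℕ} (K : XX m n) (a : ℝ) : Finset (Fin n → ℤ) :=
  (bx lam N₂ n).filter (fun j => ∃ ζ, (j, ζ) ∈ LSet lam N₁ N₂ η K a)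

lemma JJ_card (lam N₁ N₂ η : ℝ) (hl : 1 ≤ lam) (hN : 1 ≤ N₂) {m n : ℕ} (K : XX m n) (a : ℝ) :
    ((JJ lam N₁ N₂ η K a).card : ℝ) ≤ (5 * lam * N₂) ^ n :=
  le_trans (by exact_mod_cast Finset.card_filter_le _ _) (bx_card lam N₂ hl hN n)

lemma LSet_facts (lam N₁ N₂ η : ℝ) (hl : 1 ≤ lam) (hN : 1 ≤ N₂) {m n : ℕ} (K : XX m n) (a : ℝ)
    (j : Fin n → ℤ) (ζ : Fin m → ℝ) (h : (j, ζ) ∈ LSet lam N₁ N₂ η K a) :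
    (∀ i, |(j i : ℝ)| ≤ lam * (2 * N₂)) ∧ (∀ i, |ζ i| ≤ 2 * N₂) ∧
    (∑ i, (ζ i) ^ 2) + ∑ i, ((j i : ℝ) / lam) ^ 2 ≤ 4 * N₂ ^ 2 ∧
    (1 < N₁ → N₁ ^ 2 / 4 ≤ (∑ i, (K.2 i - ζ i) ^ 2) + ∑ i, (((K.1 i : ℝ) - j i) / lam) ^ 2) ∧
    a ≤ (∑ i, (K.2 i - ζ i) ^ 2) + ∑ i, (((K.1 i : ℝ) - j i) / lam) ^ 2 + ((∑ i, (ζ i) ^ 2) + ∑ i, ((j i : ℝ) / lam) ^ 2) ∧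
    (∑ i, (K.2 i - ζ i) ^ 2) + ∑ i, (((K.1 i : ℝ) - j i) / lam) ^ 2 + ((∑ i, (ζ i) ^ 2) + ∑ i, ((j i : ℝ) / lam) ^ 2) < a + η := by
  obtain ⟨⟨h1, h2⟩, h3, h4⟩ := h
  obtain ⟨b1, b2⟩ := regA_bounds lam N₂ hl (j, ζ) h2
  have e1 : phi lam (K - (j, ζ)) = (∑ i, (K.2 i - ζ i) ^ 2) + ∑ i, (((K.1 i : ℝ) - j i) / lam) ^ 2 := by
    unfold phi
    simp
  have e2 : phi lam ((j, ζ) : XX m n) = (∑ i, (ζ i) ^ 2) + ∑ i, ((j i : ℝ) / lam) ^ 2 := rfl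
  rw [e1, e2] at h3 h4
  refine ⟨b1, b2, ?_, ?_, h3, h4⟩
  · have := h2.1
    unfold freqNorm at this
    rw [Real.sqrt_le_left (by linarith)] at this
    simp only at this
    linarith
  · intro hN1
    have := h1.2 hN1
    rw [← e1]
    have h5 : freqNorm lam (K - (j, ζ)).2 (K - (j, ζ)).1 = Real.sqrt (phi lam (K - (j, ζ))) := rfl
    rw [h5] at this
    have h6 := (Real.le_sqrt' (by linarith)).mp this
    linarith

lemma muX_le (lam N₁ N₂ η : ℝ) (hl : 1 ≤ lam) (hN : 1 ≤ N₂) {m n : ℕ} (K : XX m n) (a : ℝ)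
    (V : (Fin n → ℤ) → ℝ) (hV0 : ∀ j, 0 ≤ V j)
    (hV : ∀ j ∈ JJ lam N₁ N₂ η K a, volume {ζ | (j, ζ) ∈ LSet lam N₁ N₂ η K a} ≤ ENNReal.ofReal (V j)) :
    muX m n (LSet lam N₁ N₂ η K a) ≤ ENNReal.ofReal (∑ j ∈ JJ lam N₁ N₂ η K a, V j) := by
  unfold muX
  rw [Measure.prod_apply (LSet_meas lam N₁ N₂ η K a), lintegral_count,
    ENNReal.ofReal_sum_of_nonneg (fun j _ => hV0 j)]
  rw [tsum_eq_sum (s := JJ lam N₁ N₂ η K a)]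
  · exact Finset.sum_le_sum hV
  · intro j hj
    refine measure_mono_null (t := ∅) ?_ measure_empty
    intro ζ hζ
    have hζ' : (j, ζ) ∈ LSet lam N₁ N₂ η K a := hζ
    refine hj (Finset.mem_filter.mpr ⟨(mem_bx _ _ _ _).mpr (LSet_facts lam N₁ N₂ η hl hN K a j ζ hζ').1, ζ, hζ'⟩)

def bb (lam : ℝ) {m n : ℕ} (K : XX m n) (a : ℝ) (j : Fin n → ℤ) : ℝ :=
  (a - (∑ i, (K.2 i) ^ 2) / 2 - ∑ i, (((K.1 i : ℝ) - j i) / lam) ^ 2 - ∑ i, ((j i : ℝ) / lam) ^ 2) / 2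

lemma slice_sub (lam N₁ N₂ η : ℝ) (hl : 1 ≤ lam) (hN : 1 ≤ N₂) {m n : ℕ} (K : XX m n) (a : ℝ) (j : Fin n → ℤ) :
    {ζ | (j, ζ) ∈ LSet lam N₁ N₂ η K a} ⊆ annS (2 * N₂) (bb lam K a j) (η / 2) (fun i => K.2 i / 2) := by
  intro ζ hζ
  obtain ⟨_, h2, _, _, h5, h6⟩ := LSet_facts lam N₁ N₂ η hl hN K a j ζ hζ
  have e : 2 * ∑ i, (ζ i - K.2 i / 2) ^ 2 = (∑ i, (K.2 i - ζ i) ^ 2) + (∑ i, (ζ i) ^ 2) - (∑ i, (K.2 i) ^ 2) / 2 := by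
    rw [Finset.mul_sum, Finset.sum_div, ← Finset.sum_add_distrib, ← Finset.sum_sub_distrib]
    exact Finset.sum_congr rfl fun i _ => by ring
  refine ⟨h2, ?_, ?_⟩ <;> unfold bb <;> linarith

lemma exists_big (lam N₁ N₂ η : ℝ) (hl : 1 ≤ lam) (hN : 1 ≤ N₂) (hN1 : 1 < N₁) {m n : ℕ} (hn : 1 ≤ n) (K : XX m n) (a : ℝ)
    (Y : ℝ) (hY : ∀ i, |K.2 i| ≤ Y) (hY2 : 2 * N₂ ≤ Y) (W : ℝ) (hW : W = N₁ / (8 * (m + n))) (hYW : Y < W)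
    (j : Fin n → ℤ) (ζ : Fin m → ℝ) (h : (j, ζ) ∈ LSet lam N₁ N₂ η K a) :
    ∃ i, W ≤ |(K.1 i : ℝ) / lam| := by
  by_contra! hc
  obtain ⟨h1, h2, _, h4, _, _⟩ := LSet_facts lam N₁ N₂ η hl hN K a j ζ h
  have h4 := h4 hN1
  have hlp : 0 < lam := by linarith
  have hA : ∑ i, (K.2 i - ζ i) ^ 2 ≤ ∑ i : Fin m, (2 * W) ^ 2 := by
    refine Finset.sum_le_sum fun i _ => ?_
    rw [← sq_abs]
    have := abs_sub (K.2 i) (ζ i)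
    have := hY i
    have := h2 i
    gcongr
    linarith
  have hB : ∑ i, (((K.1 i : ℝ) - j i) / lam) ^ 2 ≤ ∑ i : Fin n, (2 * W) ^ 2 := by
    refine Finset.sum_le_sum fun i _ => ?_
    rw [← sq_abs]
    gcongr
    rw [sub_div]
    have := abs_sub ((K.1 i : ℝ) / lam) (j i / lam)
    have := hc i
    have h3 : |(j i : ℝ) / lam| ≤ 2 * N₂ := by
      rw [abs_div, abs_of_pos hlp, div_le_iff₀ hlp]
      linarith [h1 i]
    linarith
  simp only [Finset.sum_const, Finset.card_univ, Fintype.card_fin, nsmul_eq_mul] at hA hB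
  have hd : (1 : ℝ) ≤ (m : ℝ) + n := by
    have : (1 : ℝ) ≤ n := by exact_mod_cast hn
    have : (0 : ℝ) ≤ m := by positivity
    linarith
  have hN' : N₁ = 8 * (m + n) * W := by rw [hW]; field_simp
  have hWp : 0 < W := by linarith
  have : N₁ ^ 2 / 4 ≤ (m + n) * (4 * W ^ 2) := by linarith
  rw [hN'] at this
  set d : ℝ := (m : ℝ) + n
  have h8 : d * (4 * W ^ 2) * 1 ≤ d * (4 * W ^ 2) * d := by gcongr
  have h9 : 0 < d * W ^ 2 := by positivity
  nlinarith

lemma card_ints (S : Finset ℤ) (L : ℝ) (hL : 0 ≤ L) (h : ∀ x ∈ S, ∀ y ∈ S, |(x : ℝ) - y| ≤ L) : (S.card : ℝ) ≤ 1 + L := by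
  rcases S.eq_empty_or_nonempty with rfl | hne
  · simp; linarith
  · have hsub : S ⊆ Finset.Icc (S.min' hne) (S.min' hne + ⌊L⌋) := by
      intro x hx
      rw [Finset.mem_Icc]
      refine ⟨S.min'_le x hx, ?_⟩
      have := (abs_le.mp (h x hx _ (S.min'_mem hne))).2
      have h2 : x - S.min' hne ≤ ⌊L⌋ := Int.le_floor.mpr (by push_cast; exact this)
      linarith
    have h1 := Finset.card_le_card hsub
    rw [Int.card_Icc] at h1
    have h0 : 0 ≤ ⌊L⌋ := Int.floor_nonneg.mpr hL
    have h2 : (S.card : ℤ) ≤ 1 + ⌊L⌋ := by omega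
    have h3 : (S.card : ℝ) ≤ 1 + ⌊L⌋ := by exact_mod_cast h2
    linarith [Int.floor_le L]

lemma count_B (lam N₁ N₂ η : ℝ) (hl : 1 ≤ lam) (hN : 1 ≤ N₂) (hη : η ≤ 1) {m n : ℕ} (K : XX m (n + 1)) (a : ℝ)
    (Y : ℝ) (hY : ∀ i, |K.2 i| ≤ Y) (hY2 : 8 * N₂ ≤ Y) (W : ℝ) (hW : 0 < W) (i : Fin (n + 1))
    (hi : W ≤ |(K.1 i : ℝ) / lam|) :
    ((JJ lam N₁ N₂ η K a).card : ℝ) ≤ (5 * lam * N₂) ^ n * (1 + lam * ((4 * m + 1) * Y * N₂ / W)) := by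
  set L : ℝ := lam * ((4 * m + 1) * Y * N₂ / W) with hL
  have hlp : 0 < lam := by linarith
  have hYp : 0 < Y := by linarith
  have hL0 : 0 ≤ L := by positivity
  set p : (Fin (n + 1) → ℤ) → (Fin n → ℤ) := fun j k => j (i.succAbove k) with hp
  have hfib : ∀ z ∈ bx lam N₂ n, (((JJ lam N₁ N₂ η K a).filter (fun j => p j = z)).card : ℝ) ≤ 1 + L := by
    intro z _
    have hinj : Set.InjOn (fun j : Fin (n + 1) → ℤ => j i) ((JJ lam N₁ N₂ η K a).filter (fun j => p j = z)) := by
      intro j hj j' hj' e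
      simp only [Finset.coe_filter, Set.mem_ofPred_eq] at hj hj'
      ext k
      rcases Fin.eq_self_or_eq_succAbove i k with rfl | ⟨k', rfl⟩
      · exact e
      · have := congrFun (hj.2.trans hj'.2.symm) k'
        exact this
    rw [← Finset.card_image_of_injOn hinj]
    refine card_ints _ L hL0 ?_
    intro x hx y hy
    obtain ⟨j, hj, rfl⟩ := Finset.mem_image.mp hx
    obtain ⟨j', hj', rfl⟩ := Finset.mem_image.mp hy
    obtain ⟨hj, hjz⟩ := Finset.mem_filter.mp hj
    obtain ⟨hj', hjz'⟩ := Finset.mem_filter.mp hj'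
    obtain ⟨_, ζ, hζ⟩ := Finset.mem_filter.mp hj
    obtain ⟨_, ζ', hζ'⟩ := Finset.mem_filter.mp hj'
    obtain ⟨_, a2, a3, _, a5, a6⟩ := LSet_facts lam N₁ N₂ η hl hN K a j ζ hζ
    obtain ⟨_, b2, b3, _, b5, b6⟩ := LSet_facts lam N₁ N₂ η hl hN K a j' ζ' hζ'
    have ez : ∀ (j : Fin (n + 1) → ℤ) (ζ : Fin m → ℝ), (∑ i, (K.2 i - ζ i) ^ 2) + ∑ i, (((K.1 i : ℝ) - j i) / lam) ^ 2 + ((∑ i, (ζ i) ^ 2) + ∑ i, ((j i : ℝ) / lam) ^ 2) =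
        (∑ i, K.2 i ^ 2) + (∑ i, ((K.1 i : ℝ) / lam) ^ 2) - 2 * (∑ i, K.2 i * ζ i) - 2 * (∑ i, (K.1 i : ℝ) / lam * (j i / lam)) 
        + 2 * ((∑ i, (ζ i) ^ 2) + ∑ i, ((j i : ℝ) / lam) ^ 2) := by
      intro j ζ
      have e1 : ∑ i, (K.2 i - ζ i) ^ 2 = (∑ i, K.2 i ^ 2) - 2 * (∑ i, K.2 i * ζ i) + ∑ i, (ζ i) ^ 2 := by
        rw [Finset.mul_sum, ← Finset.sum_sub_distrib, ← Finset.sum_add_distrib]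
        exact Finset.sum_congr rfl fun i _ => by ring
      have e2 : ∑ i, (((K.1 i : ℝ) - j i) / lam) ^ 2 = (∑ i, ((K.1 i : ℝ) / lam) ^ 2) - 2 * (∑ i, (K.1 i : ℝ) / lam * (j i / lam)) + ∑ i, ((j i : ℝ) / lam) ^ 2 := by
        rw [Finset.mul_sum, ← Finset.sum_sub_distrib, ← Finset.sum_add_distrib]
        exact Finset.sum_congr rfl fun i _ => by ring
      rw [e1, e2]; ring
    rw [ez] at a5 a6 b5 b6
    have hpos : ∀ (j : Fin (n + 1) → ℤ) (ζ : Fin m → ℝ), 0 ≤ (∑ i, (ζ i) ^ 2) + ∑ i, ((j i : ℝ) / lam) ^ 2 := by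
      intro j ζ; positivity
    have p1 := hpos j ζ
    have p2 := hpos j' ζ'
    have hin : ∀ ζ : Fin m → ℝ, (∀ i, |ζ i| ≤ 2 * N₂) → |∑ i, K.2 i * ζ i| ≤ m * (Y * (2 * N₂)) := by
      intro ζ hζ
      refine (Finset.abs_sum_le_sum_abs _ _).trans ?_
      calc _ ≤ ∑ i : Fin m, Y * (2 * N₂) := by
            refine Finset.sum_le_sum fun i _ => ?_
            rw [abs_mul]
            have := hY i
            have := hζ i
            gcongr
        _ = _ := by simp
    have q1 := abs_le.mp (hin ζ a2)
    have q2 := abs_le.mp (hin ζ' b2)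
    have hdiff : |(∑ i, (K.1 i : ℝ) / lam * (j i / lam)) - ∑ i, (K.1 i : ℝ) / lam * (j' i / lam)| ≤ (4 * m + 1) * Y * N₂ := by
      have : 1 / 2 + 4 * N₂ ^ 2 ≤ Y * N₂ := by nlinarith
      rw [abs_le]
      constructor <;> nlinarith
    rw [Fin.sum_univ_succAbove _ i, Fin.sum_univ_succAbove _ i] at hdiff
    have hsame : ∀ k, j (i.succAbove k) = j' (i.succAbove k) := fun k => congrFun (hjz.trans hjz'.symm) k
    simp only [hsame] at hdiff
    rw [add_sub_add_right_eq_sub, ← mul_sub, ← sub_div, abs_mul, abs_div (_ - _), abs_of_pos hlp] at hdiff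
    have h1 : W * (|(j i : ℝ) - j' i| / lam) ≤ (4 * m + 1) * Y * N₂ := 
      le_trans (mul_le_mul_of_nonneg_right hi (by positivity)) hdiff
    rw [hL]
    rw [mul_comm W, ← le_div_iff₀ hW, div_le_iff₀ hlp] at h1
    linarith
  have hmaps : ∀ j ∈ JJ lam N₁ N₂ η K a, p j ∈ bx lam N₂ n := by
    intro j hj
    have := (mem_bx _ _ _ _).mp (Finset.mem_filter.mp hj).1
    exact (mem_bx _ _ _ _).mpr fun k => this _
  rw [Finset.card_eq_sum_card_fiberwise (f := p) (t := bx lam N₂ n) hmaps]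
  push_cast
  calc _ ≤ ∑ z ∈ bx lam N₂ n, (1 + L) := Finset.sum_le_sum hfib
    _ = (bx lam N₂ n).card * (1 + L) := by rw [Finset.sum_const, nsmul_eq_mul]
    _ ≤ _ := by gcongr; exact bx_card lam N₂ hl hN n


lemma slice_far (lam N₁ N₂ η : ℝ) (hl : 1 ≤ lam) (hN : 1 ≤ N₂) (hη : 0 < η) {m n : ℕ} (K : XX (m + 1) n) (a : ℝ) (j : Fin n → ℤ)
    (i : Fin (m + 1)) (Y : ℝ) (hi : |K.2 i| = Y) (hY : 8 * N₂ ≤ Y) :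
    volume {ζ | (j, ζ) ∈ LSet lam N₁ N₂ η K a} ≤ ENNReal.ofReal ((4 * N₂) ^ m * η / Y) := by
  refine (measure_mono (slice_sub lam N₁ N₂ η hl hN K a j)).trans ?_
  have h2 : |K.2 i / 2| = Y / 2 := by rw [abs_div, hi, abs_two]
  refine (vol_far (2 * N₂) _ (η / 2) (by linarith) (by linarith) _ i ?_).trans (le_of_eq ?_)
  · simp only [h2]; linarith
  · simp only [h2]
    congr 1
    have : 0 < Y := by linarith
    field_simp
    ring

lemma exists_Y {m : ℕ} (ξ : Fin (m + 1) → ℝ) (N : ℝ) : ∃ Y : ℝ, 8 * N ≤ Y ∧ (∀ i, |ξ i| ≤ Y) ∧ (Y = 8 * N ∨ ∃ i, |ξ i| = Y) := by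
  obtain ⟨i, hi⟩ := Finite.exists_max (fun i => |ξ i|)
  rcases le_total (8 * N) |ξ i| with h | h
  · exact ⟨|ξ i|, h, hi, Or.inr ⟨i, rfl⟩⟩
  · exact ⟨8 * N, le_rfl, fun k => (hi k).trans h, Or.inl rfl⟩

/-- combination of counting with a uniform slice bound `V / Y` -/
lemma count_comb (lam N₁ N₂ η : ℝ) (hl : 1 ≤ lam) (hN : 1 ≤ N₂) (hη : 0 < η) (hη1 : η ≤ 1) {m n : ℕ} (K : XX m (n + 1)) (a : ℝ)
    (hN12 : N₂ ≤ N₁) (Y V : ℝ) (hY : ∀ i, |K.2 i| ≤ Y) (hY2 : 8 * N₂ ≤ Y) (hV : 0 ≤ V)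
    (hsl : ∀ j, volume {ζ | (j, ζ) ∈ LSet lam N₁ N₂ η K a} ≤ ENNReal.ofReal (V * η / Y)) :
    muX m (n + 1) (LSet lam N₁ N₂ η K a) ≤ 
      ENNReal.ofReal (lam ^ (n + 1) * (5 ^ (n + 1) * (8 * (m + n + 1) * (4 * m + 1)) * V * N₂ ^ n * (1 / (lam * Y) + N₂ / N₁)) * η) := by
  have hYp : 0 < Y := by linarith
  have hlp : 0 < lam := by linarith
  have hNp : 0 < N₂ := by linarith
  have hN1p : 0 < N₁ := by linarith
  refine (muX_le lam N₁ N₂ η hl hN K a (fun _ => V * η / Y) (fun _ => by positivity) (fun j _ => hsl j)).trans ?_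
  refine ENNReal.ofReal_le_ofReal ?_
  rw [Finset.sum_const, nsmul_eq_mul]
  set W : ℝ := N₁ / (8 * ((m : ℝ) + ((n + 1 : ℕ) : ℝ))) with hW
  have hd : (1 : ℝ) ≤ (m : ℝ) + n + 1 := by
    have : (0 : ℝ) ≤ m := by positivity
    have : (0 : ℝ) ≤ n := by positivity
    linarith
  have hW' : W = N₁ / (8 * ((m : ℝ) + n + 1)) := by rw [hW]; push_cast; ring
  have hWp : 0 < W := by rw [hW']; positivity
  have hN1W : N₁ = 8 * (m + n + 1) * W := by rw [hW']; field_simp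
  have hm1 : (1 : ℝ) ≤ 4 * m + 1 := by
    have : (0 : ℝ) ≤ m := by positivity
    linarith
  set d : ℝ := (m : ℝ) + n + 1
  set E : ℝ := 4 * (m : ℝ) + 1
  rcases le_or_gt W Y with hWY | hWY
  · have hcard := JJ_card lam N₁ N₂ η hl hN K a
    have h1 : 1 / Y ≤ 8 * d / N₁ := by
      rw [hN1W, div_le_div_iff₀ hYp (by positivity)]
      nlinarith
    calc _ ≤ (5 * lam * N₂) ^ (n + 1) * (V * η / Y) := by gcongr
      _ = (5 * lam * N₂) ^ (n + 1) * (V * η) * (1 / Y) := by ring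
      _ ≤ (5 * lam * N₂) ^ (n + 1) * (V * η) * (8 * d / N₁) := by gcongr
      _ = lam ^ (n + 1) * (5 ^ (n + 1) * (8 * d * 1) * V * N₂ ^ n * (0 + N₂ / N₁)) * η := by ring
      _ ≤ _ := by
        gcongr
        positivity
  · rcases (JJ lam N₁ N₂ η K a).eq_empty_or_nonempty with he | ⟨j, hj⟩
    · rw [he]
      simp only [Finset.card_empty, Nat.cast_zero, zero_mul]
      positivity
    · obtain ⟨_, ζ, hζ⟩ := Finset.mem_filter.mp hj
      have hN1 : 1 < N₁ := by
        rw [hN1W]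
        have : W ≤ 8 * d * W := by nlinarith
        linarith
      obtain ⟨i, hi⟩ := exists_big lam N₁ N₂ η hl hN hN1 (by omega) K a Y hY (by linarith) W hW hWY j ζ hζ
      have hcard := count_B lam N₁ N₂ η hl hN hη1 K a Y hY hY2 W hWp i hi
      have hE1 : 1 ≤ 8 * d * E := by nlinarith
      calc _ ≤ (5 * lam * N₂) ^ n * (1 + lam * (E * Y * N₂ / W)) * (V * η / Y) := by gcongr
        _ = lam ^ (n + 1) * (5 ^ n * V * N₂ ^ n * (1 * (1 / (lam * Y)) + 8 * d * E * (N₂ / N₁))) * η := by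
          rw [hN1W]
          field_simp
          ring
        _ ≤ lam ^ (n + 1) * (5 ^ (n + 1) * V * N₂ ^ n * ((8 * d * E) * (1 / (lam * Y)) + 8 * d * E * (N₂ / N₁))) * η := by
          have : (5 : ℝ) ^ n ≤ 5 ^ (n + 1) := pow_le_pow_right₀ (by norm_num) (by omega)
          gcongr
        _ = _ := by ring

lemma geom2 (m n : ℕ) : ∃ C : ℝ, 0 < C ∧ ∀ lam N₁ N₂ η : ℝ, 1 ≤ lam → 1 ≤ N₂ → N₂ ≤ N₁ → 0 < η → η ≤ 1 →
    LevelBound lam N₁ N₂ η (C * (N₂ ^ (m + n) / lam + N₂ ^ (m + n + 2) / N₁)) (m + 2) (n + 1) := by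
  refine ⟨5 ^ (n + 1) * (8 * (((m + 2 : ℕ) : ℝ) + n + 1) * (4 * ((m + 2 : ℕ) : ℝ) + 1)) * 4 ^ (m + 2), by positivity, ?_⟩
  intro lam N₁ N₂ η hl hN hN12 hη hη1 K a
  have hlp : 0 < lam := by linarith
  have hNp : 0 < N₂ := by linarith
  have hN1p : 0 < N₁ := by linarith
  obtain ⟨Y, hY2, hY, hYc⟩ := exists_Y (m := m + 1) K.2 N₂
  have hYp : 0 < Y := by linarith
  have hsl : ∀ j, volume {ζ | (j, ζ) ∈ LSet lam N₁ N₂ η K a} ≤ ENNReal.ofReal (4 ^ (m + 2) * N₂ ^ (m + 1) * η / Y) := by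
    intro j
    rcases hYc with hYc | ⟨i, hi⟩
    · refine (measure_mono (slice_sub lam N₁ N₂ η hl hN K a j)).trans ?_
      refine (vol_ann (2 * N₂) (η / 2) (by linarith) (by linarith) m _ _).trans (ENNReal.ofReal_le_ofReal ?_)
      rw [hYc, le_div_iff₀ (by linarith)]
      calc (2 * (2 * N₂)) ^ m * (Real.pi * (η / 2)) * (8 * N₂) = 4 ^ m * N₂ ^ (m + 1) * η * (4 * Real.pi) := by
            rw [show 2 * (2 * N₂) = 4 * N₂ by ring, mul_pow]; ring
        _ ≤ 4 ^ m * N₂ ^ (m + 1) * η * 16 := by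
            have := Real.pi_le_four
            gcongr; linarith
        _ = _ := by ring
    · refine (slice_far lam N₁ N₂ η hl hN hη K a j i Y hi hY2).trans (ENNReal.ofReal_le_ofReal ?_)
      rw [mul_pow]
      have : (4 : ℝ) ^ (m + 1) ≤ 4 ^ (m + 2) := pow_le_pow_right₀ (by norm_num) (by omega)
      gcongr
  refine (count_comb lam N₁ N₂ η hl hN hη hη1 K a hN12 Y _ hY hY2 (by positivity) hsl).trans ?_
  refine ENNReal.ofReal_le_ofReal ?_
  have h1 : 1 / (lam * Y) ≤ 1 / (lam * N₂) := by
    gcongr; linarith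
  calc _ ≤ lam ^ (n + 1) * (5 ^ (n + 1) * (8 * (((m + 2 : ℕ) : ℝ) + n + 1) * (4 * ((m + 2 : ℕ) : ℝ) + 1)) * (4 ^ (m + 2) * N₂ ^ (m + 1)) * N₂ ^ n * (1 / (lam * N₂) + N₂ / N₁)) * η := by
        gcongr
    _ = _ := by
        field_simp
        ring


lemma sum_inv_sqrt (M : ℕ) : ∑ i ∈ Finset.range (M + 1), (if i = 0 then (0 : ℝ) else 1 / Real.sqrt i) ≤ 2 * Real.sqrt M := by
  induction M with
  | zero => simp
  | succ M ih =>
    rw [Finset.sum_range_succ]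
    have hp : (0 : ℝ) < Real.sqrt ((M + 1 : ℕ) : ℝ) := Real.sqrt_pos.mpr (by positivity)
    have h1 : Real.sqrt ((M + 1 : ℕ) : ℝ) ^ 2 = M + 1 := by rw [Real.sq_sqrt (by positivity)]; push_cast; ring
    have h2 : Real.sqrt (M : ℝ) ^ 2 = M := Real.sq_sqrt (by positivity)
    have h0 := Real.sqrt_nonneg (M : ℝ)
    rw [if_neg (by omega)]
    set x := Real.sqrt ((M + 1 : ℕ) : ℝ)
    set y := Real.sqrt (M : ℝ)
    have : 1 / x ≤ 2 * x - 2 * y := by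
      rw [div_le_iff₀ hp]
      nlinarith [sq_nonneg (x - y)]
    linarith

/-- the lattice sum -/
lemma lattice_sum (lam σ R L : ℝ) (hl : 1 ≤ lam) (hR : 0 < R) (hL : 0 ≤ L) (J : Finset (Fin 1 → ℤ)) 
    (h1 : ∀ j ∈ J, |(j 0 : ℝ) / lam - σ| < R) (h2 : ∀ j ∈ J, R - |(j 0 : ℝ) / lam - σ| ≤ L) (V : (Fin 1 → ℤ) → ℝ)
    (hV1 : ∀ j ∈ J, V j ≤ 1) (hV2 : ∀ j ∈ J, V j ≤ 1 / Real.sqrt (R ^ 2 - ((j 0 : ℝ) / lam - σ) ^ 2)) :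
    ∑ j ∈ J, V j ≤ 2 + 4 * lam * Real.sqrt (L / R) := by
  have hlp : 0 < lam := by linarith
  set s : (Fin 1 → ℤ) → ℝ := fun j => (j 0 : ℝ) / lam - σ with hs
  set u : (Fin 1 → ℤ) → ℕ := fun j => ⌊lam * (R - |s j|)⌋₊ with hu
  set M : ℕ := ⌊lam * L⌋₊ with hM
  set f : ℕ → ℝ := fun i => (if i = 0 then 1 else 0) + Real.sqrt (lam / R) * (if i = 0 then (0 : ℝ) else 1 / Real.sqrt i) with hf
  have hfV : ∀ j ∈ J, V j ≤ f (u j) := by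
    intro j hj
    by_cases h0 : u j = 0
    · simp only [hf, h0, if_true, mul_zero, add_zero]
      exact hV1 j hj
    · simp only [hf, if_neg h0, zero_add]
      refine (hV2 j hj).trans ?_
      have hup : (0 : ℝ) < u j := by exact_mod_cast Nat.pos_of_ne_zero h0
      have h3 : (u j : ℝ) ≤ lam * (R - |s j|) := Nat.floor_le (mul_nonneg hlp.le (by linarith [h1 j hj]))
      have h4 : R * (u j) / lam ≤ R ^ 2 - s j ^ 2 := by
        rw [div_le_iff₀ hlp, ← sq_abs (s j)]
        have h5 : R * (u j) ≤ R * (lam * (R - |s j|)) := by gcongr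
        have h6 : 0 ≤ lam * ((R - |s j|) * |s j|) := mul_nonneg hlp.le (mul_nonneg (by linarith [h1 j hj]) (abs_nonneg _))
        nlinarith
      calc 1 / Real.sqrt (R ^ 2 - s j ^ 2) ≤ 1 / Real.sqrt (R * (u j) / lam) := by
            gcongr
        _ = _ := by
            rw [one_div, one_div, ← Real.sqrt_inv, ← Real.sqrt_inv, ← Real.sqrt_mul (by positivity)]
            congr 1
            field_simp
  have hmaps : ∀ j ∈ J, u j ∈ Finset.range (M + 1) := by
    intro j hj
    rw [Finset.mem_range, Nat.lt_succ_iff]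
    refine Nat.floor_le_floor ?_
    have := h2 j hj
    gcongr
  have hfib : ∀ i, ((J.filter (fun j => u j = i)).card : ℝ) ≤ 2 := by
    intro i
    have : (J.filter (fun j => u j = i)).card ≤ (Finset.univ : Finset Bool).card := by
      refine Finset.card_le_card_of_injOn (fun j => decide (0 ≤ s j)) (fun _ _ => Finset.mem_coe.mpr (Finset.mem_univ _)) ?_
      intro j hj j' hj' e
      simp only [Finset.coe_filter, Set.mem_ofPred_eq] at hj hj'
      simp only [decide_eq_decide] at e
      have hfl : u j = u j' := hj.2.trans hj'.2.symm
      have n1 : 0 ≤ lam * (R - |s j|) := mul_nonneg hlp.le (by linarith [h1 j hj.1])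
      have n2 : 0 ≤ lam * (R - |s j'|) := mul_nonneg hlp.le (by linarith [h1 j' hj'.1])
      have c1 := Nat.floor_le n1
      have c2 := Nat.floor_le n2
      have c3 := Nat.lt_floor_add_one (lam * (R - |s j|))
      have c4 := Nat.lt_floor_add_one (lam * (R - |s j'|))
      have hfl' : (⌊lam * (R - |s j|)⌋₊ : ℝ) = ⌊lam * (R - |s j'|)⌋₊ := by exact_mod_cast hfl
      have es : |s j - s j'| = |(|s j| - |s j'|)| := by
        by_cases hp : 0 ≤ s j
        · rw [abs_of_nonneg hp, abs_of_nonneg (e.mp hp)]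
        · have hp' : ¬ 0 ≤ s j' := fun h => hp (e.mpr h)
          rw [abs_of_neg (not_le.mp hp), abs_of_neg (not_le.mp hp'), ← abs_neg]
          congr 1; ring
      have d1 : |lam * (s j - s j')| < 1 := by
        rw [abs_mul, es, ← abs_mul, abs_lt]
        constructor <;> nlinarith
      have d2 : lam * (s j - s j') = ((j 0 - j' 0 : ℤ) : ℝ) := by
        simp only [hs]
        push_cast
        field_simp
        ring
      rw [d2] at d1
      have d3 : |j 0 - j' 0| < 1 := by exact_mod_cast d1
      rw [Int.abs_lt_one_iff] at d3
      ext k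
      rw [Fin.eq_zero k]
      omega
    simpa using (by exact_mod_cast this : ((J.filter (fun j => u j = i)).card : ℝ) ≤ ((Finset.univ : Finset Bool).card : ℝ))
  have hf0 : ∀ i, 0 ≤ f i := by
    intro i
    simp only [hf]
    split_ifs <;> positivity
  calc ∑ j ∈ J, V j ≤ ∑ j ∈ J, f (u j) := Finset.sum_le_sum hfV
    _ = ∑ i ∈ Finset.range (M + 1), ∑ j ∈ J.filter (fun j => u j = i), f (u j) := 
        (Finset.sum_fiberwise_of_maps_to hmaps _).symm
    _ ≤ ∑ i ∈ Finset.range (M + 1), 2 * f i := by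
        refine Finset.sum_le_sum fun i _ => ?_
        calc ∑ j ∈ J.filter (fun j => u j = i), f (u j) = ∑ j ∈ J.filter (fun j => u j = i), f i := 
              Finset.sum_congr rfl fun j hj => by rw [(Finset.mem_filter.mp hj).2]
          _ = (J.filter (fun j => u j = i)).card * f i := by rw [Finset.sum_const, nsmul_eq_mul]
          _ ≤ 2 * f i := by
              have := hf0 i
              have := hfib i
              gcongr
    _ = 2 * (1 + Real.sqrt (lam / R) * ∑ i ∈ Finset.range (M + 1), (if i = 0 then (0 : ℝ) else 1 / Real.sqrt i)) := by
        rw [← Finset.mul_sum]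
        simp only [hf]
        rw [Finset.sum_add_distrib, ← Finset.mul_sum]
        simp
    _ ≤ 2 * (1 + Real.sqrt (lam / R) * (2 * Real.sqrt (lam * L))) := by
        have := sum_inv_sqrt M
        have h5 : Real.sqrt M ≤ Real.sqrt (lam * L) := Real.sqrt_le_sqrt (Nat.floor_le (by positivity))
        gcongr
        linarith
    _ = _ := by
        have : Real.sqrt (lam / R) * Real.sqrt (lam * L) = lam * Real.sqrt (L / R) := by
          rw [← Real.sqrt_mul (by positivity), show lam / R * (lam * L) = lam ^ 2 * (L / R) by ring, 
            Real.sqrt_mul (by positivity), Real.sqrt_sq hlp.le]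
        linear_combination 4 * this

lemma vol_near (T c : ℝ) (hT : 0 < T) : 
    volume {x : ℝ | T - 1 / 2 ≤ (x - c) ^ 2 ∧ (x - c) ^ 2 < T} ≤ ENNReal.ofReal (2 * min 1 (1 / Real.sqrt T)) := by
  have hs : 0 < Real.sqrt T := Real.sqrt_pos.mpr hT
  have hsq := Real.sq_sqrt hT.le
  set r := Real.sqrt T with hr
  rcases le_or_gt T 1 with h | h
  · have hr1 : r ≤ 1 := by rw [hr]; exact Real.sqrt_le_one.mpr h
    have : {x : ℝ | T - 1 / 2 ≤ (x - c) ^ 2 ∧ (x - c) ^ 2 < T} ⊆ Set.Icc (c - 1) (c + 1) := by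
      intro x hx
      have h2 : |x - c| ≤ 1 := abs_le_one_iff_mul_self_le_one.mpr (by nlinarith [hx.2])
      have := abs_le.mp h2
      exact ⟨by linarith, by linarith⟩
    refine (measure_mono this).trans ?_
    rw [Real.volume_Icc]
    refine ENNReal.ofReal_le_ofReal ?_
    rw [min_eq_left]
    · linarith
    · rw [le_div_iff₀ hs]; linarith
  · have hT2 : 0 ≤ T - 1 / 2 := by linarith
    have hq := Real.sq_sqrt hT2
    set q := Real.sqrt (T - 1 / 2) with hqd
    have hq0 : 0 ≤ q := Real.sqrt_nonneg _
    have hqr : q ≤ r := Real.sqrt_le_sqrt (by linarith)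
    have hdiff : (r - q) ≤ 1 / (2 * r) := by
      rw [le_div_iff₀ (by positivity)]
      nlinarith
    have : {x : ℝ | T - 1 / 2 ≤ (x - c) ^ 2 ∧ (x - c) ^ 2 < T} ⊆ Set.Icc (c + q) (c + r) ∪ Set.Icc (c - r) (c - q) := by
      intro x hx
      have h1 : q ≤ |x - c| := by
        rw [hqd]; exact Real.sqrt_le_iff.mpr ⟨abs_nonneg _, by rw [sq_abs]; exact hx.1⟩
      have h2 : |x - c| ≤ r := by
        rw [hr]; exact Real.le_sqrt_of_sq_le (by rw [sq_abs]; exact hx.2.le)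
      rcases le_total 0 (x - c) with h0 | h0
      · rw [abs_of_nonneg h0] at h1 h2
        left; exact ⟨by linarith, by linarith⟩
      · rw [abs_of_nonpos h0] at h1 h2
        right; exact ⟨by linarith, by linarith⟩
    refine (measure_mono this).trans ((measure_union_le _ _).trans ?_)
    rw [Real.volume_Icc, Real.volume_Icc, ← ENNReal.ofReal_add (by linarith) (by linarith)]
    refine ENNReal.ofReal_le_ofReal ?_
    have hr1 : 1 ≤ r := by rw [hr]; exact Real.one_le_sqrt.mpr h.le
    rw [min_eq_right ((div_le_one hs).mpr hr1)]
    have e : 1 / (2 * r) = 1 / r / 2 := by field_simp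
    have : 0 < 1 / r := by positivity
    linarith


lemma geom1 (lam N₁ N₂ : ℝ) (hl : 1 ≤ lam) (hN : 1 ≤ N₂) (hN12 : N₂ ≤ N₁) :
    LevelBound lam N₁ N₂ 1 (4000 * (1 / lam + N₂ / N₁)) 1 1 := by
  intro K a
  change muX 1 1 (LSet lam N₁ N₂ 1 K a) ≤ _
  have hlp : 0 < lam := by linarith
  have hNp : 0 < N₂ := by linarith
  have hN1p : 0 < N₁ := by linarith
  obtain ⟨Y, hY2, hY, hYc⟩ := exists_Y (m := 0) K.2 N₂
  have hYp : 0 < Y := by linarith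
  rcases hYc with hYc | ⟨i, hi⟩
  swap
  · have hsl : ∀ j, volume {ζ | (j, ζ) ∈ LSet lam N₁ N₂ 1 K a} ≤ ENNReal.ofReal (1 * 1 / Y) := by
      intro j
      refine (slice_far (m := 0) lam N₁ N₂ 1 hl hN one_pos K a j i Y hi hY2).trans (le_of_eq ?_)
      simp
    refine (count_comb (m := 1) (n := 0) lam N₁ N₂ 1 hl hN one_pos le_rfl K a hN12 Y 1 hY hY2 zero_le_one hsl).trans ?_
    refine ENNReal.ofReal_le_ofReal ?_
    have h1 : 1 / (lam * Y) ≤ 1 / lam := by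
      gcongr
      nlinarith
    have h2 : 0 < 1 / lam := by positivity
    have h3 : 0 < N₂ / N₁ := by positivity
    norm_num only [Nat.cast_zero, Nat.cast_one, pow_zero, mul_one, zero_add, pow_one, add_zero] at *
    have : 400 * (1 / (lam * Y) + N₂ / N₁) ≤ 4000 * (1 / lam + N₂ / N₁) := by linarith
    exact mul_le_mul_of_nonneg_left this hlp.le
  · set ω : ℝ := (K.1 0 : ℝ) / lam with hω
    set ξ : ℝ := K.2 0 with hξ
    set P : ℝ := (a - ξ ^ 2 / 2 - ω ^ 2 / 2 + 1) / 2 with hP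
    set s : (Fin 1 → ℤ) → ℝ := fun j => (j 0 : ℝ) / lam - ω / 2 with hs
    have hbb : ∀ j, bb lam K a j = P - s j ^ 2 - 1 / 2 := by
      intro j
      simp only [bb, Fin.sum_univ_one, hP, hs, sub_div, ← hω, ← hξ]
      ring
    have hsl : ∀ j ζ, (j, ζ) ∈ LSet lam N₁ N₂ 1 K a → P - s j ^ 2 - 1 / 2 ≤ (ζ 0 - ξ / 2) ^ 2 ∧ (ζ 0 - ξ / 2) ^ 2 < P - s j ^ 2 := by
      intro j ζ h
      have := slice_sub lam N₁ N₂ 1 hl hN K a j h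
      obtain ⟨_, h2, h3⟩ := this
      rw [hbb] at h2 h3
      simp only [Fin.sum_univ_one] at h2 h3
      exact ⟨h2, by linarith⟩
    have hT : ∀ j ∈ JJ lam N₁ N₂ 1 K a, 0 < P - s j ^ 2 := by
      intro j hj
      obtain ⟨_, ζ, hζ⟩ := Finset.mem_filter.mp hj
      have := (hsl j ζ hζ).2
      linarith [sq_nonneg (ζ 0 - ξ / 2)]
    have hvol : ∀ j ∈ JJ lam N₁ N₂ 1 K a, volume {ζ | (j, ζ) ∈ LSet lam N₁ N₂ 1 K a} ≤ 
        ENNReal.ofReal (2 * min 1 (1 / Real.sqrt (P - s j ^ 2))) := by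
      intro j hj
      refine le_trans ?_ (vol_near (P - s j ^ 2) (ξ / 2) (hT j hj))
      have hmp := volume_preserving_funUnique (Fin 1) ℝ
      have hsm : Measurable (fun x : ℝ => (x - ξ / 2) ^ 2) := by fun_prop
      have hm : MeasurableSet {x : ℝ | P - s j ^ 2 - 1 / 2 ≤ (x - ξ / 2) ^ 2 ∧ (x - ξ / 2) ^ 2 < P - s j ^ 2} :=
        (measurableSet_le measurable_const hsm).inter (measurableSet_lt hsm measurable_const)
      rw [← hmp.measure_preimage hm.nullMeasurableSet]
      refine measure_mono fun ζ hζ => ?_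
      exact hsl j ζ hζ
    refine (muX_le lam N₁ N₂ 1 hl hN K a (fun j => 2 * min 1 (1 / Real.sqrt (P - s j ^ 2))) (fun j => by positivity) hvol).trans ?_
    refine ENNReal.ofReal_le_ofReal ?_
    have egoal : lam ^ 1 * (4000 * (1 / lam + N₂ / N₁)) * 1 = 4000 + 4000 * (lam * (N₂ / N₁)) := by
      field_simp
    rw [egoal, ← Finset.mul_sum]
    have hq : 0 < lam * (N₂ / N₁) := by positivity
    rcases (JJ lam N₁ N₂ 1 K a).eq_empty_or_nonempty with he | ⟨j₀, hj₀⟩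
    · rw [he, Finset.sum_empty]; linarith
    have hPp : 0 < P := by linarith [hT j₀ hj₀, sq_nonneg (s j₀)]
    have hR : 0 < Real.sqrt P := Real.sqrt_pos.mpr hPp
    have hRsq : Real.sqrt P ^ 2 = P := Real.sq_sqrt hPp.le
    set R := Real.sqrt P with hRd
    have hsR : ∀ j ∈ JJ lam N₁ N₂ 1 K a, |s j| < R := by
      intro j hj
      refine abs_lt_of_sq_lt_sq ?_ hR.le
      linarith [hT j hj]
    have key : ∀ L : ℝ, 0 ≤ L → (∀ j ∈ JJ lam N₁ N₂ 1 K a, R - |s j| ≤ L) → 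
        ∑ j ∈ JJ lam N₁ N₂ 1 K a, min 1 (1 / Real.sqrt (P - s j ^ 2)) ≤ 2 + 4 * lam * Real.sqrt (L / R) := by
      intro L hL h
      refine lattice_sum lam (ω / 2) R L hl hR hL _ hsR h _ (fun j _ => min_le_left _ _) (fun j _ => ?_)
      rw [hRsq]
      exact min_le_right _ _
    rcases le_or_gt N₁ (128 * N₂) with hc | hc
    · have h1 := key R hR.le (fun j _ => by linarith [abs_nonneg (s j)])
      rw [div_self hR.ne', Real.sqrt_one] at h1
      have h2 : 1 ≤ 128 * (N₂ / N₁) := by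
        rw [← mul_div_assoc, le_div_iff₀ hN1p]; linarith
      nlinarith
    · obtain ⟨_, ζ₀, hζ₀⟩ := Finset.mem_filter.mp hj₀
      set W : ℝ := N₁ / (8 * (((1 : ℕ) : ℝ) + ((1 : ℕ) : ℝ))) with hW
      have hW' : W = N₁ / 16 := by rw [hW]; norm_num
      obtain ⟨i, hi⟩ := exists_big lam N₁ N₂ 1 hl hN (by linarith) le_rfl K a Y hY (by linarith) W hW (by rw [hW']; linarith) j₀ ζ₀ hζ₀
      rw [Fin.eq_zero i, ← hω] at hi
      have hRW : N₁ / 64 ≤ R := by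
        have h1 := hsR j₀ hj₀
        have h2 := (LSet_facts lam N₁ N₂ 1 hl hN K a j₀ ζ₀ hζ₀).1 0
        have h3 : |(j₀ 0 : ℝ) / lam| ≤ 2 * N₂ := by
          rw [abs_div, abs_of_pos hlp, div_le_iff₀ hlp]; linarith
        have h4 : |ω / 2| ≤ |s j₀| + |(j₀ 0 : ℝ) / lam| := by
          have : ω / 2 = (j₀ 0 : ℝ) / lam - s j₀ := by simp only [hs]; ring
          rw [this]
          linarith [abs_sub ((j₀ 0 : ℝ) / lam) (s j₀)]
        rw [abs_div, abs_two] at h4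
        linarith
      have hL : ∀ j ∈ JJ lam N₁ N₂ 1 K a, R - |s j| ≤ 37 * N₂ ^ 2 / R := by
        intro j hj
        obtain ⟨_, ζ, hζ⟩ := Finset.mem_filter.mp hj
        have h1 := (hsl j ζ hζ).1
        have h2 := (LSet_facts lam N₁ N₂ 1 hl hN K a j ζ hζ).2.1 0
        have h3 := hY 0
        have h4 : |ζ 0 - ξ / 2| ≤ 6 * N₂ := by
          have := abs_sub (ζ 0) (ξ / 2)
          rw [abs_div ξ, abs_two] at this
          have : |ξ| ≤ Y := h3
          linarith
        have h5 : (ζ 0 - ξ / 2) ^ 2 ≤ (6 * N₂) ^ 2 := sq_le_sq' (abs_le.mp h4).1 (abs_le.mp h4).2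
        rw [le_div_iff₀ hR]
        have h6 : (R - |s j|) * R ≤ (R - |s j|) * (R + |s j|) := by
          have := hsR j hj
          have := abs_nonneg (s j)
          refine mul_le_mul_of_nonneg_left ?_ ?_ <;> linarith
        have h7 : (R - |s j|) * (R + |s j|) = P - s j ^ 2 := by
          rw [← hRsq, ← sq_abs (s j)]; ring
        nlinarith
      have h1 := key _ (by positivity) hL
      have h2 : Real.sqrt (37 * N₂ ^ 2 / R / R) ≤ 448 * (N₂ / N₁) := by
        refine Real.sqrt_le_iff.mpr ⟨by positivity, ?_⟩
        have h3 : N₂ / R ≤ 64 * (N₂ / N₁) := by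
          rw [div_le_iff₀ hR, ← mul_div_assoc, div_mul_eq_mul_div, le_div_iff₀ hN1p]
          nlinarith
        have h4 : (N₂ / R) ^ 2 ≤ (64 * (N₂ / N₁)) ^ 2 := pow_le_pow_left₀ (by positivity) h3 2
        have h5 : 37 * N₂ ^ 2 / R / R = 37 * (N₂ / R) ^ 2 := by field_simp
        rw [h5]
        nlinarith
      have h3 : lam * Real.sqrt (37 * N₂ ^ 2 / R / R) ≤ lam * (448 * (N₂ / N₁)) := mul_le_mul_of_nonneg_left h2 hlp.le
      nlinarith

/-- **Bilinear Strichartz estimates on rescaled waveguides (Proposition 1.1).**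
(i) Local-in-time estimate on `ℝ × 𝕋_λ` (`m = n = 1`);
(ii) global-in-time estimate on `ℝ^m × 𝕋ⁿ_λ` for `m ≥ 2`, `n ≥ 1`, `d = m + n`. -/
theorem bilinear_strichartz_waveguide :
    (∃ C : ℝ, 0 < C ∧
      ∀ (lam N₁ N₂ : ℝ) (g₁ g₂ : (Fin 1 → ℝ) → (Fin 1 → ℤ) → ℂ),
        1 ≤ lam → IsDyadic N₁ → IsDyadic N₂ → N₂ ≤ N₁ → 1 ≤ N₂ →
        SuppIn lam g₁ N₁ → SuppIn lam g₂ N₂ →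
        (∫⁻ t in Set.Icc (0 : ℝ) 1, ∫⁻ x : Fin 1 → ℝ, ∫⁻ y in torusBox lam 1,
            (‖waveU lam g₁ t x y * waveU lam g₂ t x y‖₊ : ℝ≥0∞) ^ 2) ^ (1 / 2 : ℝ)
          ≤ ENNReal.ofReal (C * Real.sqrt (1 / lam + N₂ / N₁))
              * (l2sq lam g₁) ^ (1 / 2 : ℝ) * (l2sq lam g₂) ^ (1 / 2 : ℝ)) ∧
    (∀ m n : ℕ, 2 ≤ m → 1 ≤ n → ∃ C : ℝ, 0 < C ∧
      ∀ (lam N₁ N₂ : ℝ) (g₁ g₂ : (Fin m → ℝ) → (Fin n → ℤ) → ℂ),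
        1 ≤ lam → IsDyadic N₁ → IsDyadic N₂ → N₂ ≤ N₁ → 1 ≤ N₂ →
        SuppIn lam g₁ N₁ → SuppIn lam g₂ N₂ →
        (∫⁻ t : ℝ, ∫⁻ x : Fin m → ℝ, ∫⁻ y in torusBox lam n,
            (‖waveU lam g₁ t x y * waveU lam g₂ t x y‖₊ : ℝ≥0∞) ^ 2) ^ (1 / 2 : ℝ)
          ≤ ENNReal.ofReal (C * Real.sqrt
                (N₂ ^ (((m : ℝ) + n) - 3) / lam + N₂ ^ (((m : ℝ) + n) - 1) / N₁))
              * (l2sq lam g₁) ^ (1 / 2 : ℝ) * (l2sq lam g₂) ^ (1 / 2 : ℝ)) := by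
  constructor
  · have hK := Kc_nonneg 1 1
    refine ⟨Real.sqrt (2 * (Kc 1 1 + 1) * 4000), Real.sqrt_pos.mpr (by positivity), ?_⟩
    intro lam N₁ N₂ g₁ g₂ hl _ _ hN12 hN hs₁ hs₂
    have hlp : 0 < lam := by linarith
    have hNp : 0 < N₂ := by linarith
    have hN1p : 0 < N₁ := by linarith
    refine rpow_final _ _ _ _ _ (by positivity) ?_
    have h := time_box lam N₁ N₂ 1 (4000 * (1 / lam + N₂ / N₁)) hl one_pos (by positivity) g₁ g₂ hs₁ hs₂
      (by rw [div_one]; exact geom1 lam N₁ N₂ hl hN hN12)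
    rw [← mul_assoc] at h
    refine le_trans ?_ h
    exact lintegral_mono_set (Set.Icc_subset_Icc (by norm_num) le_rfl)
  · intro m n hm hn
    obtain ⟨m, rfl⟩ : ∃ m', m = m' + 2 := ⟨m - 2, by omega⟩
    obtain ⟨n, rfl⟩ : ∃ n', n = n' + 1 := ⟨n - 1, by omega⟩
    have hK := Kc_nonneg (m + 2) (n + 1)
    obtain ⟨C, hC, hgeo⟩ := geom2 m n
    refine ⟨Real.sqrt (2 * (Kc (m + 2) (n + 1) + 1) * C), Real.sqrt_pos.mpr (by positivity), ?_⟩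
    intro lam N₁ N₂ g₁ g₂ hl _ _ hN12 hN hs₁ hs₂
    have hlp : 0 < lam := by linarith
    have hNp : 0 < N₂ := by linarith
    have hN1p : 0 < N₁ := by linarith
    have e1 : N₂ ^ ((((m + 2 : ℕ) : ℝ) + ((n + 1 : ℕ) : ℝ)) - 3) = N₂ ^ (m + n) := by
      rw [← Real.rpow_natCast]; congr 1; push_cast; ring
    have e2 : N₂ ^ ((((m + 2 : ℕ) : ℝ) + ((n + 1 : ℕ) : ℝ)) - 1) = N₂ ^ (m + n + 2) := by
      rw [← Real.rpow_natCast]; congr 1; push_cast; ring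
    rw [e1, e2]
    refine rpow_final _ _ _ _ _ (by positivity) ?_
    have h := time_global lam N₁ N₂ (C * (N₂ ^ (m + n) / lam + N₂ ^ (m + n + 2) / N₁)) hl (by positivity) g₁ g₂ hs₁ hs₂
      (fun η h0 h1 => hgeo lam N₁ N₂ η hl hN hN12 h0 h1)
    rw [← mul_assoc] at h
    exact h
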